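/- There exists a connected finite-dimensional algebra A over a field k admitting a 2-cluster tilting module, together with a simple A-module S whose complexity is infinite. Concretely, for A = kQ/J² with Q the quiver 1 ⇄ 2 ⇄ 3, the module A ⊕ D(A) is a 2-cluster tilting A-module and the simple module S₂ at the middle vertex has infinite complexity. -/

import Mathlib

/-!
We formalize statements about the algebra `A = kQ/J²`, where `Q` is the quiver
`1 ⇄ 2 ⇄ 3` and `J` is the arrow ideal of the path algebra `kQ`.
The algebra `A` is presented by generators and relations as a quotient of the
free algebra on three vertex idempotents and four arrows.
Right `A`-modules are treated as left modules over `Aᵐᵒᵖ`.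
-/

open CategoryTheory Opposite

/-- Generators of the path algebra `kQ`: three vertex idempotents `e i`
and four arrows `ar a`, where the arrows of `Q` are
`α : 1 → 2`, `β : 2 → 1`, `γ : 2 → 3`, `δ : 3 → 2`. -/
inductive QGen : Type
  | e : Fin 3 → QGen
  | ar : Fin 4 → QGen

/-- The sources of the four arrows `α, β, γ, δ` (vertices `1,2,3` are `0,1,2 : Fin 3`). -/
def arrowSrc : Fin 4 → Fin 3 := ![0, 1, 1, 2]

/-- The targets of the four arrows `α, β, γ, δ`. -/
def arrowTgt : Fin 4 → Fin 3 := ![1, 0, 2, 1]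

/-- The defining relations of `A = kQ/J²`: the `e i` are orthogonal idempotents summing
to `1`, the arrows are compatible with their sources and targets, and any product of
two arrows vanishes (`J² = 0`). -/
inductive ARel (k : Type) [Field k] : FreeAlgebra k QGen → FreeAlgebra k QGen → Prop
  | idem (i j : Fin 3) :
      ARel k (FreeAlgebra.ι k (QGen.e i) * FreeAlgebra.ι k (QGen.e j))
        (if i = j then FreeAlgebra.ι k (QGen.e i) else 0)
  | sum : ARel k
      (FreeAlgebra.ι k (QGen.e 0) + FreeAlgebra.ι k (QGen.e 1) + FreeAlgebra.ι k (QGen.e 2)) 1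
  | src (a : Fin 4) :
      ARel k (FreeAlgebra.ι k (QGen.e (arrowSrc a)) * FreeAlgebra.ι k (QGen.ar a))
        (FreeAlgebra.ι k (QGen.ar a))
  | tgt (a : Fin 4) :
      ARel k (FreeAlgebra.ι k (QGen.ar a) * FreeAlgebra.ι k (QGen.e (arrowTgt a)))
        (FreeAlgebra.ι k (QGen.ar a))
  | radsq (a b : Fin 4) :
      ARel k (FreeAlgebra.ι k (QGen.ar a) * FreeAlgebra.ι k (QGen.ar b)) 0

/-- The algebra `A = kQ/J²`. -/
abbrev AlgA (k : Type) [Field k] : Type := RingQuot (ARel k)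

/-- Right `A`-modules are left modules over `Aop k = Aᵐᵒᵖ`. -/
abbrev Aop (k : Type) [Field k] : Type := (AlgA k)ᵐᵒᵖ

/-- The algebra homomorphism `A → k` corresponding to the vertex `i`. -/
noncomputable def simpleAlgHom (k : Type) [Field k] (i : Fin 3) : AlgA k →ₐ[k] k :=
  RingQuot.liftAlgHom k
    ⟨FreeAlgebra.lift k (fun g => match g with
        | QGen.e j => if j = i then (1 : k) else 0
        | QGen.ar _ => 0), by
      intro _x _y h
      induction h with
      | idem i j =>
          simp only [map_mul, FreeAlgebra.lift_ι_apply, apply_ite, map_zero]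
          split_ifs <;> simp_all
      | sum =>
          simp only [map_add, map_one, FreeAlgebra.lift_ι_apply]
          fin_cases i <;> simp
      | src a => simp [FreeAlgebra.lift_ι_apply]
      | tgt a => simp [FreeAlgebra.lift_ι_apply]
      | radsq a b => simp [FreeAlgebra.lift_ι_apply]⟩

/-- The ring homomorphism `Aᵐᵒᵖ → k` corresponding to the vertex `i`. -/
noncomputable def simpleRingHom (k : Type) [Field k] (i : Fin 3) : Aop k →+* k :=
  RingHom.fromOpposite (simpleAlgHom k i).toRingHom (fun _ _ => mul_comm _ _)

/-- The simple right `A`-module `S_{i+1}` at the vertex `i` (one-dimensional over `k`,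
with `e i` acting as the identity and all arrows acting by zero).
So `SimpleS k 0 = S₁`, `SimpleS k 1 = S₂` and `SimpleS k 2 = S₃`. -/
def SimpleS (k : Type) [Field k] (_i : Fin 3) : Type := k

instance (k : Type) [Field k] (i : Fin 3) : AddCommGroup (SimpleS k i) :=
  inferInstanceAs (AddCommGroup k)

instance (k : Type) [Field k] (i : Fin 3) : Module k (SimpleS k i) :=
  inferInstanceAs (Module k k)

noncomputable instance (k : Type) [Field k] (i : Fin 3) : Module (Aop k) (SimpleS k i) :=
  Module.compHom (SimpleS k i) (simpleRingHom k i)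

/-- The underlying type of `D(A) = Hom_k(A, k)`. -/
abbrev DualA (k : Type) [Field k] : Type := AlgA k →ₗ[k] k

/-- The right `A`-module structure on `D(A)`: `(φ · a) x = φ (a * x)`. -/
noncomputable instance (k : Type) [Field k] : Module (Aop k) (DualA k) where
  smul a φ := φ.comp (LinearMap.mulLeft k a.unop)
  one_smul φ := by
    show φ.comp (LinearMap.mulLeft k ((1 : Aop k).unop)) = φ
    ext x; simp
  mul_smul a b φ := by
    show φ.comp (LinearMap.mulLeft k ((a * b).unop)) =
      (φ.comp (LinearMap.mulLeft k b.unop)).comp (LinearMap.mulLeft k a.unop)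
    ext x; simp [mul_assoc]
  smul_zero a := by
    show (0 : DualA k).comp (LinearMap.mulLeft k a.unop) = 0
    ext x; simp
  smul_add a φ ψ := by
    show (φ + ψ).comp (LinearMap.mulLeft k a.unop) =
      φ.comp (LinearMap.mulLeft k a.unop) + ψ.comp (LinearMap.mulLeft k a.unop)
    ext x; simp
  add_smul a b φ := by
    show φ.comp (LinearMap.mulLeft k ((a + b).unop)) =
      φ.comp (LinearMap.mulLeft k a.unop) + φ.comp (LinearMap.mulLeft k b.unop)
    ext x; simp [add_mul]
  zero_smul φ := by
    show φ.comp (LinearMap.mulLeft k ((0 : Aop k).unop)) = 0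
    ext x; simp

/-- The right `A`-module `M = A ⊕ D(A)`, where `A` carries the right regular
`A`-module structure. -/
abbrev MA (k : Type) [Field k] : Type := AlgA k × DualA k

/-- `X` belongs to `add M`: `X` is (isomorphic to) a direct summand of `Mⁿ` for some `n`. -/
def InAdd (k : Type) [Field k] (M X : Type) [AddCommGroup M] [Module (Aop k) M]
    [AddCommGroup X] [Module (Aop k) X] : Prop :=
  ∃ (n : ℕ) (ι : X →ₗ[Aop k] (Fin n → M)) (π : (Fin n → M) →ₗ[Aop k] X),
    π.comp ι = LinearMap.id

/-- `Ext^i_A(X, Y)` for right `A`-modules `X` and `Y`, computed in the abelian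
category of all right `A`-modules (which has the same `Ext` groups as `mod A`). -/
noncomputable def ExtA (k : Type) [Field k] (X Y : Type) [AddCommGroup X] [Module (Aop k) X]
    [AddCommGroup Y] [Module (Aop k) Y] (i : ℕ) : Type :=
  ((Ext ℤ (ModuleCat (Aop k)) i).obj (op (ModuleCat.of (Aop k) X))).obj (ModuleCat.of (Aop k) Y)

/-- `M` is a 2-cluster tilting right `A`-module:
`add M = {X ∈ mod A | Ext¹_A(M,X) = 0} = {X ∈ mod A | Ext¹_A(X,M) = 0}`. -/
def IsTwoClusterTilting (k : Type) [Field k] (M : Type) [AddCommGroup M]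
    [Module (Aop k) M] : Prop :=
  (∀ (X : Type) [AddCommGroup X] [Module (Aop k) X], Module.Finite (Aop k) X →
    (InAdd k M X ↔ Subsingleton (ExtA k M X 1))) ∧
  (∀ (X : Type) [AddCommGroup X] [Module (Aop k) X], Module.Finite (Aop k) X →
    (InAdd k M X ↔ Subsingleton (ExtA k X M 1)))

/-- The data `(P, ε, d)` is a minimal projective resolution
`⋯ → P 1 → P 0 → N → 0` of the right `A`-module `N`: all the `P n` are projective,
the complex is exact, and all the kernels are superfluous submodules (i.e. each
induced map onto a syzygy is a projective cover). -/
def IsMinimalProjRes (k : Type) [Field k] {N : Type} [AddCommGroup N] [Module (Aop k) N]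
    (P : ℕ → Type) [∀ n, AddCommGroup (P n)] [∀ n, Module (Aop k) (P n)]
    (ε : P 0 →ₗ[Aop k] N) (d : ∀ n, P (n + 1) →ₗ[Aop k] P n) : Prop :=
  (∀ n, Module.Projective (Aop k) (P n)) ∧
  Function.Surjective ε ∧
  LinearMap.range (d 0) = LinearMap.ker ε ∧
  (∀ n, LinearMap.range (d (n + 1)) = LinearMap.ker (d n)) ∧
  (∀ K : Submodule (Aop k) (P 0), K ⊔ LinearMap.ker ε = ⊤ → K = ⊤) ∧
  (∀ n, ∀ K : Submodule (Aop k) (P (n + 1)), K ⊔ LinearMap.ker (d n) = ⊤ → K = ⊤)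

/-- Every extension of `X` by `Y` splits: homomorphisms to `Y` extend from the kernel of any
surjection onto `X`. -/
def ExtensionsSplit (R : Type) [Ring R] (X Y : Type) [AddCommGroup X] [Module R X]
    [AddCommGroup Y] [Module R Y] : Prop :=
  ∀ (E : Type) [AddCommGroup E] [Module R E] (q : E →ₗ[R] X), Function.Surjective q →
    ∀ f : LinearMap.ker q →ₗ[R] Y, ∃ g : E →ₗ[R] Y, ∀ z : LinearMap.ker q, g z = f z

section

variable {R : Type} [Ring R] {X Y : Type} [AddCommGroup X] [Module R X]
  [AddCommGroup Y] [Module R Y]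

theorem extensionsSplit_of_projective {P : Type} [AddCommGroup P] [Module R P]
    [Module.Projective R P] (p : P →ₗ[R] X) (hp : Function.Surjective p)
    (H : ∀ f : LinearMap.ker p →ₗ[R] Y, ∃ g : P →ₗ[R] Y, ∀ z : LinearMap.ker p, g z = f z) :
    ExtensionsSplit R X Y := by
  intro E _ _ q hq f
  obtain ⟨h, hh⟩ := Module.projective_lifting_property q p hq
  have hh' : ∀ x, q (h x) = p x := fun x => LinearMap.congr_fun hh x
  obtain ⟨g, hg⟩ := H (f.comp (h.restrict (p := LinearMap.ker p) (q := LinearMap.ker q)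
    (fun x hx => by simpa [hh'] using hx)))
  let s : (LinearMap.ker q × P) →ₗ[R] E := (LinearMap.ker q).subtype.coprod h
  have hs : Function.Surjective s := by
    intro e
    obtain ⟨x, hx⟩ := hp (q e)
    refine ⟨(⟨e - h x, by simp [hh', hx]⟩, x), by simp [s]⟩
  let t : (LinearMap.ker q × P) →ₗ[R] Y := f.coprod g
  have hst : LinearMap.ker s ≤ LinearMap.ker t := by
    rintro ⟨z, x⟩ hzx
    have h0 : (z : E) + h x = 0 := by simpa [s] using hzx
    have hx : p x = 0 := by
      have := congrArg q h0
      simpa [hh', z.2] using this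
    have h1 := hg ⟨x, hx⟩
    have h2 : (h.restrict (p := LinearMap.ker p) (q := LinearMap.ker q)
      (fun x hx => by simpa [hh'] using hx)) ⟨x, hx⟩ = -z := by
      ext
      simpa using (neg_eq_of_add_eq_zero_right h0).symm
    have h3 : g x = - f z := by
      rw [h1, LinearMap.comp_apply, h2, map_neg]
    simp [t, h3]
  refine ⟨((LinearMap.ker s).liftQ t hst).comp (s.quotKerEquivOfSurjective hs).symm.toLinearMap, ?_⟩
  intro z
  have : (s.quotKerEquivOfSurjective hs).symm (z : E) = Submodule.Quotient.mk (z, 0) := by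
    rw [LinearEquiv.symm_apply_eq]
    simp [s]
  simp [this, t]

theorem ExtensionsSplit.of_retract {Z : Type} [AddCommGroup Z] [Module R Z]
    (H : ExtensionsSplit R Z Y) (i : X →ₗ[R] Z) (r : Z →ₗ[R] X) (hr : r.comp i = LinearMap.id) :
    ExtensionsSplit R X Y := by
  intro E _ _ q hq f
  have hri : ∀ x, r (i x) = x := fun x => LinearMap.congr_fun hr x
  let E' : Submodule R (E × Z) := LinearMap.eqLocus (q.comp (LinearMap.fst R E Z))
    (r.comp (LinearMap.snd R E Z))
  let q' : E' →ₗ[R] Z := (LinearMap.snd R E Z).comp E'.subtype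
  have hq' : Function.Surjective q' := by
    intro z
    obtain ⟨e, he⟩ := hq (r z)
    exact ⟨⟨(e, z), he⟩, rfl⟩
  let u : LinearMap.ker q' →ₗ[R] LinearMap.ker q :=
    LinearMap.codRestrict _ ((LinearMap.fst R E Z).comp (E'.subtype.comp
      (LinearMap.ker q').subtype)) (by
        rintro ⟨⟨⟨e, z⟩, h1⟩, h2⟩
        have h1' : q e = r z := h1
        have h2' : z = 0 := h2
        simp [h1', h2'])
  obtain ⟨g, hg⟩ := H E' q' hq' (f.comp u)
  let v : E →ₗ[R] E' := LinearMap.codRestrict _ (LinearMap.prod LinearMap.id (i.comp q)) (by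
    intro e
    simp [E', hri])
  refine ⟨g.comp v, ?_⟩
  rintro ⟨z, hz⟩
  have hz' : q z = 0 := hz
  have hv : v z ∈ LinearMap.ker q' := by
    simp [v, q', hz']
  have := hg ⟨v z, hv⟩
  rw [LinearMap.comp_apply, this, LinearMap.comp_apply]
  rfl

theorem ExtensionsSplit.prod {Z : Type} [AddCommGroup Z] [Module R Z]
    (hX : ExtensionsSplit R X Y) (hZ : ExtensionsSplit R Z Y) : ExtensionsSplit R (X × Z) Y := by
  let p : (X →₀ R) →ₗ[R] X := Finsupp.linearCombination R id
  have hp : Function.Surjective p := Finsupp.linearCombination_id_surjective R X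
  let r : (Z →₀ R) →ₗ[R] Z := Finsupp.linearCombination R id
  have hr : Function.Surjective r := Finsupp.linearCombination_id_surjective R Z
  refine extensionsSplit_of_projective (p.prodMap r) (hp.prodMap hr) fun f => ?_
  obtain ⟨g₁, hg₁⟩ := hX _ p hp (f.comp ((LinearMap.inl R _ _).restrict
    (fun x hx => by simpa using hx)))
  obtain ⟨g₂, hg₂⟩ := hZ _ r hr (f.comp ((LinearMap.inr R _ _).restrict
    (fun x hx => by simpa using hx)))
  refine ⟨g₁.coprod g₂, ?_⟩
  rintro ⟨⟨x, z⟩, h⟩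
  have hx : p x = 0 := congrArg Prod.fst h
  have hz : r z = 0 := congrArg Prod.snd h
  have h₁ := hg₁ ⟨x, hx⟩
  have h₂ := hg₂ ⟨z, hz⟩
  simp only [LinearMap.coprod_apply]
  erw [h₁, h₂]
  simp only [LinearMap.comp_apply]
  rw [← map_add]
  congr 1
  ext <;> simp

theorem ExtensionsSplit.pi (n : ℕ) (hX : ExtensionsSplit R X Y) :
    ExtensionsSplit R (Fin n → X) Y := by
  let p : (X →₀ R) →ₗ[R] X := Finsupp.linearCombination R id
  have hp : Function.Surjective p := Finsupp.linearCombination_id_surjective R X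
  refine extensionsSplit_of_projective (P := Fin n → (X →₀ R))
    (LinearMap.pi fun i => p.comp (LinearMap.proj i))
    (fun x => ⟨fun i => (hp (x i)).choose, funext fun i => (hp (x i)).choose_spec⟩) fun f => ?_
  have hs : ∀ i, ∀ x ∈ LinearMap.ker p, LinearMap.single R (fun _ : Fin n => X →₀ R) i x ∈
      LinearMap.ker (LinearMap.pi fun i => p.comp (LinearMap.proj i)) := by
    intro i x hx
    ext j
    have hx' : p x = 0 := hx
    by_cases hij : j = i
    · subst hij; simp [hx']
    · simp [hij]
  choose g hg using fun i => hX _ p hp (f.comp ((LinearMap.single R (fun _ : Fin n => X →₀ R) i).restrict (hs i)))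
  refine ⟨∑ i, (g i).comp (LinearMap.proj i), ?_⟩
  rintro ⟨x, h⟩
  have hx : ∀ i, p (x i) = 0 := fun i => congrFun h i
  have h' := fun i => hg i ⟨x i, hx i⟩
  simp only [LinearMap.coe_sum, Finset.sum_apply, LinearMap.comp_apply, LinearMap.proj_apply] at h' ⊢
  rw [Finset.sum_congr rfl fun i _ => h' i, ← map_sum]
  congr 1
  ext1
  simp only [AddSubmonoidClass.coe_finsetSum, LinearMap.coe_restrict_apply]
  exact Finset.univ_sum_single x

theorem subsingleton_ext_one_iff (P : ProjectiveResolution (ModuleCat.of R X)) :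
    Subsingleton (((Ext ℤ (ModuleCat R) 1).obj (op (ModuleCat.of R X))).obj (ModuleCat.of R Y)) ↔
      ∀ f : P.complex.X 1 ⟶ ModuleCat.of R Y, P.complex.d 2 1 ≫ f = 0 →
        ∃ g : P.complex.X 0 ⟶ ModuleCat.of R Y, P.complex.d 1 0 ≫ g = f := by
  rw [← ModuleCat.isZero_iff_subsingleton, (P.isoExt 1 (ModuleCat.of R Y)).isZero_iff,
    ← HomologicalComplex.exactAt_iff_isZero_homology,
    HomologicalComplex.exactAt_iff' _ 0 1 2 (by simp) (by simp),
    ShortComplex.moduleCat_exact_iff]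
  rfl

theorem extensionsSplit_iff_subsingleton_ext :
    ExtensionsSplit R X Y ↔ Subsingleton
      (((Ext ℤ (ModuleCat R) 1).obj (op (ModuleCat.of R X))).obj (ModuleCat.of R Y)) := by
  let P := ProjectiveResolution.of (ModuleCat.of R X)
  let p : P.complex.X 0 →ₗ[R] X :=
    (P.π.f 0 ≫ (HomologicalComplex.singleObjXSelf (ComplexShape.down ℕ) 0 (ModuleCat.of R X)).hom).hom
  let d₁ : P.complex.X 1 →ₗ[R] P.complex.X 0 := (P.complex.d 1 0).hom
  let d₂ : P.complex.X 2 →ₗ[R] P.complex.X 1 := (P.complex.d 2 1).hom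
  have hp : Function.Surjective p := by
    rw [← ModuleCat.epi_iff_surjective]
    infer_instance
  have hd₁ : LinearMap.range d₁ = LinearMap.ker p := by
    refine ((ShortComplex.moduleCat_exact_iff_range_eq_ker _).1 P.exact₀).trans ?_
    change LinearMap.ker (P.π.f 0).hom = LinearMap.ker p
    rw [show p = _ from ModuleCat.hom_comp _ _, LinearMap.ker_comp_of_ker_eq_bot]
    exact LinearMap.ker_eq_bot_of_injective ((ModuleCat.mono_iff_injective _).1 inferInstance)
  have hd₂ : LinearMap.range d₂ = LinearMap.ker d₁ :=
    (ShortComplex.moduleCat_exact_iff_range_eq_ker _).1 (P.exact_succ 0)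
  have : Module.Projective R (P.complex.X 0) :=
    (IsProjective.iff_projective _).2 (P.projective 0)
  rw [subsingleton_ext_one_iff P]
  constructor
  · intro H f hf
    have hf' : LinearMap.ker d₁ ≤ LinearMap.ker f.hom := by
      rw [← hd₂]
      rintro _ ⟨x, rfl⟩
      exact LinearMap.congr_fun (congrArg ModuleCat.Hom.hom hf) x
    let φ : LinearMap.range d₁ →ₗ[R] Y :=
      ((LinearMap.ker d₁).liftQ f.hom hf').comp d₁.quotKerEquivRange.symm.toLinearMap
    obtain ⟨g, hg⟩ := H _ p hp (φ.comp (LinearEquiv.ofEq _ _ hd₁).symm.toLinearMap)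
    refine ⟨ModuleCat.ofHom g, ?_⟩
    ext x
    have hx : d₁ x ∈ LinearMap.ker p := hd₁ ▸ LinearMap.mem_range_self d₁ x
    have h1 := hg ⟨d₁ x, hx⟩
    have h2 : d₁.quotKerEquivRange.symm ⟨d₁ x, LinearMap.mem_range_self d₁ x⟩ =
        Submodule.Quotient.mk x := by
      rw [LinearEquiv.symm_apply_eq]
      rfl
    refine h1.trans ?_
    change (LinearMap.ker d₁).liftQ f.hom hf'
      (d₁.quotKerEquivRange.symm ⟨d₁ x, LinearMap.mem_range_self d₁ x⟩) = _
    rw [h2]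
    rfl
  · intro H
    refine extensionsSplit_of_projective p hp fun f => ?_
    have hm : ∀ x, d₁ x ∈ LinearMap.ker p := fun x => hd₁ ▸ LinearMap.mem_range_self d₁ x
    obtain ⟨g, hg⟩ := H (ModuleCat.ofHom (f.comp (d₁.codRestrict _ hm))) (by
      ext x
      have h0 : d₁ (d₂ x) = 0 := by
        have : d₂ x ∈ LinearMap.ker d₁ := hd₂ ▸ LinearMap.mem_range_self d₂ x
        exact this
      change f (d₁.codRestrict _ hm (d₂ x)) = 0
      rw [show d₁.codRestrict _ hm (d₂ x) = 0 from Subtype.ext h0, map_zero])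
    refine ⟨g.hom, ?_⟩
    rintro ⟨z, hz⟩
    obtain ⟨x, rfl⟩ : z ∈ LinearMap.range d₁ := hd₁ ▸ hz
    exact LinearMap.congr_fun (congrArg ModuleCat.Hom.hom hg) x

end

/-- The vertex idempotent `e i`, as an element of `Aᵐᵒᵖ`. -/
noncomputable def vtx (k : Type) [Field k] (i : Fin 3) : Aop k :=
  MulOpposite.op (RingQuot.mkAlgHom k (ARel k) (FreeAlgebra.ι k (QGen.e i)))

/-- The arrow `a`, as an element of `Aᵐᵒᵖ`. -/
noncomputable def arr (k : Type) [Field k] (a : Fin 4) : Aop k :=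
  MulOpposite.op (RingQuot.mkAlgHom k (ARel k) (FreeAlgebra.ι k (QGen.ar a)))

section Presentation

variable {k : Type} [Field k]

theorem vtx_mul_vtx (i j : Fin 3) : vtx k i * vtx k j = if i = j then vtx k i else 0 := by
  have := RingQuot.mkAlgHom_rel k (ARel.idem (k := k) j i)
  rw [vtx, vtx, ← MulOpposite.op_mul, ← map_mul, this]
  by_cases h : i = j
  · simp [h]
  · simp [h, Ne.symm h]

theorem sum_vtx : ∑ i, vtx k i = 1 := by
  have := RingQuot.mkAlgHom_rel k (ARel.sum (k := k))
  rw [map_one, map_add, map_add] at this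
  rw [Fin.sum_univ_three, vtx, vtx, vtx, ← MulOpposite.op_add, ← MulOpposite.op_add, this,
    MulOpposite.op_one]

theorem arr_mul_src (a : Fin 4) : arr k a * vtx k (arrowSrc a) = arr k a := by
  have := RingQuot.mkAlgHom_rel k (ARel.src (k := k) a)
  rw [arr, vtx, ← MulOpposite.op_mul, ← map_mul, this]

theorem tgt_mul_arr (a : Fin 4) : vtx k (arrowTgt a) * arr k a = arr k a := by
  have := RingQuot.mkAlgHom_rel k (ARel.tgt (k := k) a)
  rw [arr, vtx, ← MulOpposite.op_mul, ← map_mul, this]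

theorem arr_mul_arr (a b : Fin 4) : arr k a * arr k b = 0 := by
  have := RingQuot.mkAlgHom_rel k (ARel.radsq (k := k) b a)
  rw [arr, arr, ← MulOpposite.op_mul, ← map_mul, this, map_zero, MulOpposite.op_zero]

theorem arr_mul_vtx (a : Fin 4) (i : Fin 3) :
    arr k a * vtx k i = if i = arrowSrc a then arr k a else 0 := by
  rw [← arr_mul_src a, mul_assoc, vtx_mul_vtx]
  by_cases h : i = arrowSrc a
  · simp [h, arr_mul_src]
  · simp [h, Ne.symm h]

theorem vtx_mul_arr (i : Fin 3) (a : Fin 4) :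
    vtx k i * arr k a = if i = arrowTgt a then arr k a else 0 := by
  rw [← tgt_mul_arr a, ← mul_assoc, vtx_mul_vtx]
  by_cases h : i = arrowTgt a
  · simp [h, tgt_mul_arr]
  · simp [h]

/-- The two-dimensional representation of `A` attached to an arrow `a`. -/
noncomputable def arrowRep (k : Type) [Field k] (a : Fin 4) :
    AlgA k →ₐ[k] Matrix (Fin 2) (Fin 2) k :=
  RingQuot.liftAlgHom k
    ⟨FreeAlgebra.lift k (fun g => match g with
        | QGen.e j => !![if j = arrowSrc a then (1 : k) else 0, 0;
            0, if j = arrowTgt a then 1 else 0]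
        | QGen.ar b => !![0, if b = a then (1 : k) else 0; 0, 0]), by
      intro _x _y h
      induction h with
      | idem i j =>
          simp only [map_mul, FreeAlgebra.lift_ι_apply, apply_ite, map_zero, Matrix.mul_fin_two]
          rcases eq_or_ne i j with rfl | h
          · simp
          · rw [if_neg h]
            ext p q
            fin_cases p <;> fin_cases q <;> simp <;> grind
      | sum =>
          simp only [map_add, map_one, FreeAlgebra.lift_ι_apply]
          fin_cases a <;> ext p q <;> fin_cases p <;> fin_cases q <;> simp [arrowSrc, arrowTgt]
      | src b =>
          simp only [map_mul, FreeAlgebra.lift_ι_apply, Matrix.mul_fin_two]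
          by_cases h : b = a <;> simp [h]
      | tgt b =>
          simp only [map_mul, FreeAlgebra.lift_ι_apply, Matrix.mul_fin_two]
          by_cases h : b = a <;> simp [h]
      | radsq b c =>
          simp only [map_mul, FreeAlgebra.lift_ι_apply, map_zero, Matrix.mul_fin_two]
          ext p q
          fin_cases p <;> fin_cases q <;> simp⟩

/-- The coefficient of `e i` in an element of `Aᵐᵒᵖ`. -/
noncomputable def vtxCoef (k : Type) [Field k] (i : Fin 3) : Aop k →ₗ[k] k :=
  (simpleAlgHom k i).toLinearMap ∘ₗ (MulOpposite.opLinearEquiv k).symm.toLinearMap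

/-- The coefficient of the arrow `a` in an element of `Aᵐᵒᵖ`. -/
noncomputable def arrCoef (k : Type) [Field k] (a : Fin 4) : Aop k →ₗ[k] k :=
  LinearMap.proj (1 : Fin 2) ∘ₗ LinearMap.proj (0 : Fin 2) ∘ₗ (arrowRep k a).toLinearMap ∘ₗ
    (MulOpposite.opLinearEquiv k).symm.toLinearMap

@[simp]
theorem vtxCoef_vtx (i j : Fin 3) : vtxCoef k i (vtx k j) = if j = i then 1 else 0 := by
  simp [vtxCoef, vtx, simpleAlgHom]

@[simp]
theorem vtxCoef_arr (i : Fin 3) (a : Fin 4) : vtxCoef k i (arr k a) = 0 := by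
  simp [vtxCoef, arr, simpleAlgHom]

@[simp]
theorem vtxCoef_one (i : Fin 3) : vtxCoef k i 1 = 1 := by
  simp [vtxCoef]

theorem vtxCoef_mul (i : Fin 3) (x y : Aop k) :
    vtxCoef k i (x * y) = vtxCoef k i x * vtxCoef k i y := by
  simp [vtxCoef, mul_comm]

@[simp]
theorem arrCoef_vtx (a : Fin 4) (j : Fin 3) : arrCoef k a (vtx k j) = 0 := by
  change arrowRep k a _ 0 1 = 0
  simp [arrowRep, vtx]

@[simp]
theorem arrCoef_arr (a b : Fin 4) : arrCoef k a (arr k b) = if b = a then 1 else 0 := by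
  change arrowRep k a _ 0 1 = _
  simp [arrowRep, arr]

/-- An element of `Aᵐᵒᵖ` is determined by its coefficients. -/
theorem eq_sum_coef (x : Aop k) :
    x = ∑ i, vtxCoef k i x • vtx k i + ∑ a, arrCoef k a x • arr k a := by
  let S : Submodule k (Aop k) := LinearMap.eqLocus LinearMap.id
    (∑ i, (vtxCoef k i).smulRight (vtx k i) + ∑ a, (arrCoef k a).smulRight (arr k a))
  have mem_S : ∀ y : Aop k, y ∈ S ↔
      y = ∑ i, vtxCoef k i y • vtx k i + ∑ a, arrCoef k a y • arr k a := by
    intro y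
    simp [S, LinearMap.mem_eqLocus]
  have hv : ∀ j, vtx k j ∈ S := fun j => by simp [mem_S]
  have ha : ∀ a, arr k a ∈ S := fun a => by simp [mem_S]
  have h1 : (1 : Aop k) ∈ S := by
    rw [← sum_vtx]
    exact sum_mem fun i _ => hv i
  have key : ∀ w : FreeAlgebra k QGen, ∀ y ∈ S,
      y * MulOpposite.op (RingQuot.mkAlgHom k (ARel k) w) ∈ S := by
    intro w
    induction w using FreeAlgebra.induction with
    | grade0 r =>
      intro y hy
      rw [AlgHom.commutes, ← MulOpposite.algebraMap_apply, ← Algebra.commutes, ← Algebra.smul_def]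
      exact S.smul_mem r hy
    | grade1 g =>
      intro y hy
      rw [(mem_S y).1 hy, add_mul, Finset.sum_mul, Finset.sum_mul]
      refine add_mem (sum_mem fun i _ => ?_) (sum_mem fun a _ => ?_) <;>
        rw [smul_mul_assoc] <;> refine S.smul_mem _ ?_ <;> cases g
      · rw [← vtx, vtx_mul_vtx]
        split_ifs
        exacts [hv _, zero_mem _]
      · rw [← arr, vtx_mul_arr]
        split_ifs
        exacts [ha _, zero_mem _]
      · rw [← vtx, arr_mul_vtx]
        split_ifs
        exacts [ha _, zero_mem _]
      · rw [← arr, arr_mul_arr]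
        exact zero_mem _
    | mul w₁ w₂ h₁ h₂ =>
      intro y hy
      rw [map_mul, MulOpposite.op_mul, ← mul_assoc]
      exact h₁ _ (h₂ _ hy)
    | add w₁ w₂ h₁ h₂ =>
      intro y hy
      rw [map_add, MulOpposite.op_add, mul_add]
      exact add_mem (h₁ _ hy) (h₂ _ hy)
  obtain ⟨w, hw⟩ := RingQuot.mkAlgHom_surjective k (ARel k) x.unop
  have := key w 1 h1
  rw [one_mul, hw, MulOpposite.op_unop] at this
  exact (mem_S x).1 this

theorem arrCoef_mul (a : Fin 4) (x y : Aop k) :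
    arrCoef k a (x * y) = vtxCoef k (arrowTgt a) x * arrCoef k a y +
      arrCoef k a x * vtxCoef k (arrowSrc a) y := by
  conv_lhs => rw [eq_sum_coef x, eq_sum_coef y]
  simp only [add_mul, mul_add, Finset.sum_mul, Finset.mul_sum, smul_mul_smul_comm, map_add, map_sum, map_smul,
    vtx_mul_vtx, vtx_mul_arr, arr_mul_vtx, arr_mul_arr, apply_ite (arrCoef k a), map_zero,
    arrCoef_vtx, arrCoef_arr, smul_eq_mul]
  rw [add_comm]
  simp only [mul_ite, mul_zero, mul_one, Finset.sum_ite_eq',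
    Finset.mem_univ, if_true, Finset.sum_const_zero, add_zero, zero_add]
  rw [Finset.sum_comm]
  simp [add_comm]

end Presentation

section Algebra

variable {k : Type} [Field k]

theorem finite_aop : Module.Finite k (Aop k) := by
  refine Module.finite_def.2 (Submodule.fg_def.2
    ⟨Set.range (vtx k) ∪ Set.range (arr k), (Set.finite_range _).union (Set.finite_range _), ?_⟩)
  rw [eq_top_iff]
  intro x _
  rw [eq_sum_coef x]
  refine add_mem (sum_mem fun i _ => Submodule.smul_mem _ _ (Submodule.subset_span ?_))
    (sum_mem fun a _ => Submodule.smul_mem _ _ (Submodule.subset_span ?_)) <;> simp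

theorem finiteDimensional_algA : FiniteDimensional k (AlgA k) :=
  have := finite_aop (k := k)
  Module.Finite.equiv (MulOpposite.opLinearEquiv k).symm

theorem arr_mul_eq (a : Fin 4) (x : Aop k) : arr k a * x = vtxCoef k (arrowSrc a) x • arr k a := by
  conv_lhs => rw [eq_sum_coef x]
  simp [mul_add, Finset.mul_sum, arr_mul_vtx, arr_mul_arr]

theorem mul_arr_eq (a : Fin 4) (x : Aop k) : x * arr k a = vtxCoef k (arrowTgt a) x • arr k a := by
  conv_lhs => rw [eq_sum_coef x]
  simp [add_mul, Finset.sum_mul, vtx_mul_arr, arr_mul_arr]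

theorem arr_ne_zero (a : Fin 4) : arr k a ≠ 0 := by
  intro h
  have := arrCoef_arr (k := k) a a
  simp [h] at this

theorem eq_zero_or_one_of_central_idempotent (z : AlgA k) (hz : z ∈ Subring.center (AlgA k))
    (h : z * z = z) : z = 0 ∨ z = 1 := by
  rw [Subring.mem_center_iff] at hz
  obtain ⟨x, rfl⟩ := MulOpposite.unop_surjective z
  have hc : ∀ y : Aop k, x * y = y * x := fun y =>
    MulOpposite.unop_injective (hz y.unop)
  have hi : x * x = x := MulOpposite.unop_injective h
  have hv : ∀ a, vtxCoef k (arrowSrc a) x = vtxCoef k (arrowTgt a) x := by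
    intro a
    have := hc (arr k a)
    rw [arr_mul_eq, mul_arr_eq] at this
    exact (smul_left_injective k (arr_ne_zero a) this).symm
  have h01 : vtxCoef k 0 x = vtxCoef k 1 x := hv 0
  have h12 : vtxCoef k 1 x = vtxCoef k 2 x := hv 2
  have ha : ∀ a, arrCoef k a x = 0 := by
    intro a
    have := congrArg (arrCoef k a) (hc (vtx k (arrowSrc a)))
    have hne : arrowSrc a ≠ arrowTgt a := by fin_cases a <;> simp [arrowSrc, arrowTgt]
    simpa [arrCoef_mul, hne] using this
  have hx : x = vtxCoef k 0 x • 1 := by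
    conv_lhs => rw [eq_sum_coef x]
    rw [← sum_vtx]
    simp [ha, Fin.sum_univ_three, ← h12, h01]
  have h0 : vtxCoef k 0 x * vtxCoef k 0 x = vtxCoef k 0 x := by
    rw [← vtxCoef_mul, hi]
  rcases IsIdempotentElem.iff_eq_zero_or_one.1 h0 with h | h <;> rw [h] at hx
  · left; rw [hx]; simp
  · right; rw [hx]; simp

theorem smul_simpleS (i : Fin 3) (x : Aop k) (s : SimpleS k i) : x • s = vtxCoef k i x • s :=
  rfl

instance (i : Fin 3) : IsScalarTower k (Aop k) (SimpleS k i) where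
  smul_assoc c x s := by
    rw [smul_simpleS, smul_simpleS, map_smul, smul_assoc]

theorem isSimpleModule_simpleS (i : Fin 3) : IsSimpleModule (Aop k) (SimpleS k i) := by
  have : IsSimpleModule k (SimpleS k i) := inferInstanceAs (IsSimpleModule k k)
  rw [isSimpleModule_iff_toSpanSingleton_surjective] at this ⊢
  refine ⟨this.1, fun s hs t => ?_⟩
  obtain ⟨c, hc⟩ := this.2 s hs t
  exact ⟨algebraMap k (Aop k) c, (algebraMap_smul (Aop k) c s).trans hc⟩

end Algebra

section Modules

variable {k : Type} [Field k] {X Y : Type} [AddCommGroup X] [Module (Aop k) X]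
  [AddCommGroup Y] [Module (Aop k) Y]

theorem sum_vtx_smul (x : X) : vtx k 0 • x + vtx k 1 • x + vtx k 2 • x = x := by
  rw [← add_smul, ← add_smul, ← Fin.sum_univ_three, sum_vtx, one_smul]

theorem vtx_smul_vtx_smul (i j : Fin 3) (x : X) :
    vtx k i • vtx k j • x = if i = j then vtx k i • x else 0 := by
  rw [smul_smul, vtx_mul_vtx]
  split_ifs <;> simp

theorem vtx_smul_arr_smul (i : Fin 3) (a : Fin 4) (x : X) :
    vtx k i • arr k a • x = if i = arrowTgt a then arr k a • x else 0 := by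
  rw [smul_smul, vtx_mul_arr]
  split_ifs <;> simp

theorem arr_smul_vtx_smul (a : Fin 4) (i : Fin 3) (x : X) :
    arr k a • vtx k i • x = if i = arrowSrc a then arr k a • x else 0 := by
  rw [smul_smul, arr_mul_vtx]
  split_ifs <;> simp

theorem arr_smul_arr_smul (a b : Fin 4) (x : X) : arr k a • arr k b • x = 0 := by
  rw [smul_smul, arr_mul_arr, zero_smul]

/-- A `k`-linear map commuting with the vertices and the arrows is a homomorphism of modules. -/
noncomputable def repHom [Module k X] [IsScalarTower k (Aop k) X] [Module k Y]
    [IsScalarTower k (Aop k) Y] (f : X →ₗ[k] Y) (hv : ∀ i x, f (vtx k i • x) = vtx k i • f x)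
    (ha : ∀ a x, f (arr k a • x) = arr k a • f x) : X →ₗ[Aop k] Y where
  toFun := f
  map_add' := map_add f
  map_smul' r x := by
    rw [RingHom.id_apply, eq_sum_coef r]
    simp only [add_smul, Finset.sum_smul, smul_assoc, map_add, map_sum, map_smul, hv, ha]

@[simp]
theorem repHom_apply [Module k X] [IsScalarTower k (Aop k) X] [Module k Y]
    [IsScalarTower k (Aop k) Y] (f : X →ₗ[k] Y) (hv : ∀ i x, f (vtx k i • x) = vtx k i • f x)
    (ha : ∀ a x, f (arr k a • x) = arr k a • f x) (x : X) : repHom f hv ha x = f x :=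
  rfl

/-- Every element of the socle of `X` belongs to the radical of `X`. -/
def SocleLeRadical (k : Type) [Field k] (X : Type) [AddCommGroup X] [Module (Aop k) X] : Prop :=
  ∀ x : X, (∀ a, arr k a • x = 0) → ∃ y : Fin 4 → X, x = ∑ a, arr k a • y a

theorem SocleLeRadical.of_retract (h : SocleLeRadical k Y) (i : X →ₗ[Aop k] Y)
    (r : Y →ₗ[Aop k] X) (hr : r.comp i = LinearMap.id) : SocleLeRadical k X := by
  intro x hx
  obtain ⟨y, hy⟩ := h (i x) fun a => by rw [← map_smul, hx, map_zero]
  refine ⟨fun a => r (y a), ?_⟩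
  have : r (i x) = x := LinearMap.congr_fun hr x
  rw [← this, hy]
  simp

theorem SocleLeRadical.pi (h : SocleLeRadical k Y) (n : ℕ) : SocleLeRadical k (Fin n → Y) := by
  intro x hx
  choose y hy using fun i => h (x i) fun a => congrFun (hx a) i
  refine ⟨fun a i => y i a, funext fun i => ?_⟩
  rw [hy i]
  simp

theorem SocleLeRadical.prod (hX : SocleLeRadical k X) (hY : SocleLeRadical k Y) :
    SocleLeRadical k (X × Y) := by
  rintro ⟨x, y⟩ h
  obtain ⟨u, hu⟩ := hX x fun a => congrArg Prod.fst (h a)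
  obtain ⟨v, hv⟩ := hY y fun a => congrArg Prod.snd (h a)
  refine ⟨fun a => (u a, v a), ?_⟩
  ext <;> simp [hu, hv, Prod.fst_sum, Prod.snd_sum]

theorem InAdd.socleLeRadical (hY : SocleLeRadical k Y) (h : InAdd k Y X) :
    SocleLeRadical k X := by
  obtain ⟨n, ι, π, hπ⟩ := h
  exact (hY.pi n).of_retract ι π hπ

/-- The right regular module as a left module over `Aᵐᵒᵖ`. -/
noncomputable def opEquiv (k : Type) [Field k] : AlgA k ≃ₗ[Aop k] Aop k where
  toFun := MulOpposite.op
  invFun := MulOpposite.unop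
  left_inv _ := rfl
  right_inv _ := rfl
  map_add' _ _ := rfl
  map_smul' _ _ := rfl

theorem socleLeRadical_aop : SocleLeRadical k (Aop k) := by
  intro x hx
  have hv : ∀ a, vtxCoef k (arrowSrc a) x = 0 := fun a =>
    (smul_eq_zero.1 ((arr_mul_eq a x).symm.trans (hx a))).resolve_right (arr_ne_zero a)
  have h0 : vtxCoef k 0 x = 0 := hv 0
  have h1 : vtxCoef k 1 x = 0 := hv 1
  have h2 : vtxCoef k 2 x = 0 := hv 3
  refine ⟨fun a => arrCoef k a x • 1, ?_⟩
  conv_lhs => rw [eq_sum_coef x]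
  simp [Fin.sum_univ_three, h0, h1, h2]

instance : IsScalarTower k (Aop k) (DualA k) where
  smul_assoc c x φ := by
    ext y
    change φ ((c • x).unop * y) = c • φ (x.unop * y)
    simp

/-- The functional dual to the vertex `i`. -/
noncomputable def vtxDual (k : Type) [Field k] (i : Fin 3) : DualA k :=
  vtxCoef k i ∘ₗ (MulOpposite.opLinearEquiv k).toLinearMap

/-- The functional dual to the arrow `a`. -/
noncomputable def arrDual (k : Type) [Field k] (a : Fin 4) : DualA k :=
  arrCoef k a ∘ₗ (MulOpposite.opLinearEquiv k).toLinearMap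

theorem vtxDual_apply (i : Fin 3) (x : Aop k) : vtxDual k i x.unop = vtxCoef k i x := rfl

theorem arrDual_apply (a : Fin 4) (x : Aop k) : arrDual k a x.unop = arrCoef k a x := rfl

theorem dualA_ext {φ ψ : DualA k} (h : ∀ x : Aop k, φ x.unop = ψ x.unop) : φ = ψ :=
  LinearMap.ext fun x => h (MulOpposite.op x)

theorem smul_dualA_unop (x : Aop k) (φ : DualA k) (y : Aop k) :
    (x • φ) y.unop = φ (y * x).unop :=
  rfl

theorem vtx_smul_arrDual (i : Fin 3) (a : Fin 4) :
    vtx k i • arrDual k a = if i = arrowSrc a then arrDual k a else 0 := by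
  refine dualA_ext fun x => ?_
  rw [smul_dualA_unop, arrDual_apply, arrCoef_mul, vtxCoef_vtx, arrCoef_vtx]
  split_ifs <;> simp [arrDual_apply]

theorem arr_smul_arrDual (a b : Fin 4) :
    arr k a • arrDual k b = if a = b then vtxDual k (arrowTgt b) else 0 := by
  refine dualA_ext fun x => ?_
  rw [smul_dualA_unop, arrDual_apply, arrCoef_mul, vtxCoef_arr, arrCoef_arr]
  split_ifs <;> simp [vtxDual_apply]

theorem dualA_eq_sum (φ : DualA k) : φ = ∑ i, φ (vtx k i).unop • vtxDual k i +
    ∑ a, φ (arr k a).unop • arrDual k a := by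
  refine dualA_ext fun x => ?_
  conv_lhs => rw [eq_sum_coef x]
  simp [vtxDual_apply, arrDual_apply, mul_comm]

theorem socleLeRadical_dualA : SocleLeRadical k (DualA k) := by
  intro φ hφ
  have ha : ∀ a, φ (arr k a).unop = 0 := by
    intro a
    have := LinearMap.congr_fun (hφ a) (1 : Aop k).unop
    rw [smul_dualA_unop, one_mul] at this
    exact this
  refine ⟨![φ (vtx k 1).unop • arrDual k 0, φ (vtx k 0).unop • arrDual k 1,
    φ (vtx k 2).unop • arrDual k 2, 0], ?_⟩
  conv_lhs => rw [dualA_eq_sum φ]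
  simp [ha, Fin.sum_univ_three, Fin.sum_univ_four, smul_comm (arr k _) (φ _), arr_smul_arrDual,
    arrowTgt]
  abel

theorem socleLeRadical_mA : SocleLeRadical k (MA k) :=
  (socleLeRadical_aop.of_retract (opEquiv k).toLinearMap (opEquiv k).symm.toLinearMap
    (by ext; simp)).prod socleLeRadical_dualA

end Modules

section Presentation

variable {k : Type} [Field k]

theorem smul_arrDual (x : Aop k) (a : Fin 4) : x • arrDual k a =
    vtxCoef k (arrowSrc a) x • arrDual k a + arrCoef k a x • vtxDual k (arrowTgt a) := by
  conv_lhs => rw [eq_sum_coef x]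
  simp [add_smul, Finset.sum_smul, vtx_smul_arrDual, arr_smul_arrDual]

/-- The free presentation of `D(A)` given by the functionals dual to the arrows. -/
noncomputable def dualCover (k : Type) [Field k] : (Fin 4 → Aop k) →ₗ[Aop k] DualA k :=
  Fintype.linearCombination (Aop k) (arrDual k)

theorem dualCover_apply (x : Fin 4 → Aop k) : dualCover k x = ∑ a, x a • arrDual k a := rfl

theorem dualCover_apply' (x : Fin 4 → Aop k) : dualCover k x =
    ∑ a, vtxCoef k (arrowSrc a) (x a) • arrDual k a + (arrCoef k 1 (x 1) • vtxDual k 0 +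
      (arrCoef k 0 (x 0) + arrCoef k 3 (x 3)) • vtxDual k 1 + arrCoef k 2 (x 2) • vtxDual k 2) := by
  simp only [dualCover_apply, smul_arrDual, Finset.sum_add_distrib]
  congr 1
  simp [Fin.sum_univ_four, arrowTgt, add_smul]
  abel

theorem dualCover_surjective : Function.Surjective (dualCover k) := by
  intro φ
  refine ⟨fun a => φ (arr k a).unop • vtx k (arrowSrc a) +
    (![φ (vtx k 1).unop, φ (vtx k 0).unop, φ (vtx k 2).unop, 0] : Fin 4 → k) a • arr k a, ?_⟩
  rw [dualCover_apply']
  conv_rhs => rw [dualA_eq_sum φ]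
  simp [Fin.sum_univ_three]
  abel

theorem mem_ker_dualCover (x : Fin 4 → Aop k) : x ∈ LinearMap.ker (dualCover k) ↔
    (∀ a, vtxCoef k (arrowSrc a) (x a) = 0) ∧ arrCoef k 1 (x 1) = 0 ∧
      arrCoef k 0 (x 0) + arrCoef k 3 (x 3) = 0 ∧ arrCoef k 2 (x 2) = 0 := by
  rw [LinearMap.mem_ker, dualCover_apply']
  constructor
  · intro h
    refine ⟨fun a => ?_, ?_, ?_, ?_⟩
    · simpa [vtxDual, arrDual] using LinearMap.congr_fun h (arr k a).unop
    · simpa [vtxDual, arrDual] using LinearMap.congr_fun h (vtx k 0).unop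
    · simpa [vtxDual, arrDual] using LinearMap.congr_fun h (vtx k 1).unop
    · simpa [vtxDual, arrDual] using LinearMap.congr_fun h (vtx k 2).unop
  · rintro ⟨h, h1, h2, h3⟩
    simp [h, h1, h2, h3]

/-- The elements `1 - e i` in the kernel of `dualCover k`. -/
noncomputable def syzygyVtx (k : Type) [Field k] (a : Fin 4) : LinearMap.ker (dualCover k) :=
  ⟨Pi.single a (1 - vtx k (arrowSrc a)), by
    rw [LinearMap.mem_ker, dualCover_apply, Finset.sum_eq_single a] <;>
      simp +contextual [sub_smul, vtx_smul_arrDual]⟩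

/-- The element of the kernel of `dualCover k` generating a simple summand at the vertex `1`. -/
noncomputable def syzygyβ (k : Type) [Field k] : LinearMap.ker (dualCover k) :=
  ⟨Pi.single 2 (arr k 1), by rw [mem_ker_dualCover]; simp [Pi.single_apply, apply_ite]⟩

/-- The element of the kernel of `dualCover k` generating a simple summand at the vertex `3`. -/
noncomputable def syzygyγ (k : Type) [Field k] : LinearMap.ker (dualCover k) :=
  ⟨Pi.single 1 (arr k 2), by rw [mem_ker_dualCover]; simp [Pi.single_apply, apply_ite]⟩

/-- The element of the kernel of `dualCover k` generating a simple summand at the vertex `2`. -/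
noncomputable def syzygyαδ (k : Type) [Field k] : LinearMap.ker (dualCover k) :=
  ⟨Pi.single 0 (arr k 0) - Pi.single 3 (arr k 3), by
    rw [mem_ker_dualCover]
    refine ⟨fun a => ?_, by simp, by simp, by simp⟩
    fin_cases a <;> simp⟩

theorem mul_vtx_eq (x : Aop k) (i : Fin 3) : x * vtx k i =
    vtxCoef k i x • vtx k i + ∑ a, if i = arrowSrc a then arrCoef k a x • arr k a else 0 := by
  conv_lhs => rw [eq_sum_coef x]
  simp [add_mul, Finset.sum_mul, vtx_mul_vtx, arr_mul_vtx]

theorem ker_dualCover_eq (z : LinearMap.ker (dualCover k)) :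
    z = ∑ a, z.1 a • syzygyVtx k a + ((arrCoef k 1 (z.1 2)) • (1 : Aop k)) • syzygyβ k +
      ((arrCoef k 2 (z.1 1)) • (1 : Aop k)) • syzygyγ k +
      ((arrCoef k 0 (z.1 0)) • (1 : Aop k)) • syzygyαδ k := by
  obtain ⟨x, hx⟩ := z
  obtain ⟨h, h1, h2, h3⟩ := (mem_ker_dualCover x).1 hx
  have h4 : arrCoef k 3 (x 3) = - arrCoef k 0 (x 0) := (neg_eq_of_add_eq_zero_right h2).symm
  have hx0 := mul_vtx_eq (x 0) (arrowSrc 0)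
  have hx1 := mul_vtx_eq (x 1) (arrowSrc 1)
  have hx2 := mul_vtx_eq (x 2) (arrowSrc 2)
  have hx3 := mul_vtx_eq (x 3) (arrowSrc 3)
  rw [h] at hx0 hx1 hx2 hx3
  simp only [arrowSrc, Fin.sum_univ_four] at hx0 hx1 hx2 hx3
  simp at hx0 hx1 hx2 hx3
  ext1
  funext a
  fin_cases a <;>
    simp [syzygyVtx, syzygyβ, syzygyγ, syzygyαδ, Fin.sum_univ_four, mul_sub,
      hx0, hx1, hx2, hx3, h1, h3, h4, arrowSrc]
  module

theorem extensionsSplit_dualA {Y : Type} [AddCommGroup Y] [Module (Aop k) Y]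
    (hY : SocleLeRadical k Y) : ExtensionsSplit (Aop k) (DualA k) Y := by
  refine extensionsSplit_of_projective (dualCover k) dualCover_surjective fun f => ?_
  have hrad : ∀ z : LinearMap.ker (dualCover k), (∀ a, arr k a • z = 0) → ∀ i, vtx k i • z = z →
      ∃ y : Fin 4 → Y, f z = ∑ a, if i = arrowTgt a then arr k a • y a else 0 := by
    intro z hz i hi
    obtain ⟨y, hy⟩ := hY (f z) fun a => by rw [← map_smul, hz, map_zero]
    refine ⟨y, ?_⟩
    rw [← hi, map_smul, hy, Finset.smul_sum]
    simp_rw [vtx_smul_arr_smul]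
  have hβ : ∃ y, f (syzygyβ k) = arr k 1 • y := by
    obtain ⟨y, hy⟩ := hrad (syzygyβ k) (fun a => by
      ext1; funext b; simp [syzygyβ, Pi.single_apply, arr_mul_arr]) 0 (by
      ext1; funext b; simp [syzygyβ, Pi.single_apply, vtx_mul_arr, arrowTgt])
    exact ⟨y 1, by simpa [Fin.sum_univ_four, arrowTgt] using hy⟩
  have hγ : ∃ y, f (syzygyγ k) = arr k 2 • y := by
    obtain ⟨y, hy⟩ := hrad (syzygyγ k) (fun a => by
      ext1; funext b; simp [syzygyγ, Pi.single_apply, arr_mul_arr]) 2 (by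
      ext1; funext b; simp [syzygyγ, Pi.single_apply, vtx_mul_arr, arrowTgt])
    exact ⟨y 2, by simpa [Fin.sum_univ_four, arrowTgt] using hy⟩
  have hαδ : ∃ y y', f (syzygyαδ k) = arr k 0 • y + arr k 3 • y' := by
    obtain ⟨y, hy⟩ := hrad (syzygyαδ k) (fun a => by
      ext1; funext b; simp [syzygyαδ, Pi.single_apply, arr_mul_arr, mul_sub]) 1 (by
      ext1; funext b; simp [syzygyαδ, Pi.single_apply, vtx_mul_arr, arrowTgt, mul_sub])
    exact ⟨y 0, y 3, by simpa [Fin.sum_univ_four, arrowTgt] using hy⟩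
  obtain ⟨yβ, hβ⟩ := hβ
  obtain ⟨yγ, hγ⟩ := hγ
  obtain ⟨yα, yδ, hαδ⟩ := hαδ
  let y : Fin 4 → Y := ![yα, yγ, yβ, -yδ]
  let g : (Fin 4 → Aop k) →ₗ[Aop k] Y := Fintype.linearCombination (Aop k)
    fun a => vtx k (arrowSrc a) • y a + f (syzygyVtx k a)
  have hv : ∀ a, vtx k (arrowSrc a) • f (syzygyVtx k a) = 0 := by
    intro a
    rw [← map_smul, ← map_zero f]
    congr 1
    ext1; funext b
    simp [syzygyVtx, Pi.single_apply, mul_sub, vtx_mul_vtx]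
  have ha : ∀ b a, arrowSrc b = arrowSrc a → arr k b • f (syzygyVtx k a) = 0 := by
    intro b a h
    rw [← arr_mul_src b, mul_smul, h, hv, smul_zero]
  have hg : ∀ a x, g (Pi.single a x) = x • (vtx k (arrowSrc a) • y a + f (syzygyVtx k a)) := by
    intro a x
    simp [g]
  have h0 : ∀ a, g (syzygyVtx k a) = f (syzygyVtx k a) := by
    intro a
    change g (Pi.single a _) = _
    simp [hg, sub_smul, vtx_smul_vtx_smul, hv]
  have h1 : g (syzygyβ k) = f (syzygyβ k) := by
    change g (Pi.single 2 _) = _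
    rw [hg, smul_add, ha 1 2 rfl, hβ]
    simp [arr_smul_vtx_smul, arrowSrc, y]
  have h2 : g (syzygyγ k) = f (syzygyγ k) := by
    change g (Pi.single 1 _) = _
    rw [hg, smul_add, ha 2 1 rfl, hγ]
    simp [arr_smul_vtx_smul, arrowSrc, y]
  have h3 : g (syzygyαδ k) = f (syzygyαδ k) := by
    change g (Pi.single 0 _ - Pi.single 3 _) = _
    rw [map_sub, hg, hg, smul_add, smul_add, ha 0 0 rfl, ha 3 3 rfl, hαδ]
    simp [arr_smul_vtx_smul, arrowSrc, y]
  refine ⟨g, fun z => ?_⟩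
  rw [ker_dualCover_eq z]
  simp only [Submodule.coe_add, Submodule.coe_sum, Submodule.coe_smul, map_add, map_sum, map_smul,
    h0, h1, h2, h3]

theorem extensionsSplit_mA {Y : Type} [AddCommGroup Y] [Module (Aop k) Y]
    (hY : SocleLeRadical k Y) : ExtensionsSplit (Aop k) (MA k) Y := by
  refine ExtensionsSplit.prod ?_ (extensionsSplit_dualA hY)
  refine extensionsSplit_of_projective (opEquiv k).symm.toLinearMap (opEquiv k).symm.surjective
    fun f => ⟨0, fun z => ?_⟩
  have hz : (z : Aop k) = 0 := (opEquiv k).symm.injective (by simpa using z.2)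
  have hz' : z = 0 := Subtype.ext hz
  simp [hz']

/-- If all extensions of `D(A)` by `X` split, the socle of `X` is contained in its radical. -/
theorem socleLeRadical_of_extensionsSplit_dualA {X : Type} [AddCommGroup X] [Module (Aop k) X]
    (H : ExtensionsSplit (Aop k) (DualA k) X) : SocleLeRadical k X := by
  intro x hx
  let _ : Module k X := Module.compHom X (algebraMap k (Aop k))
  have : IsScalarTower k (Aop k) X := ⟨fun c r x => by
    rw [Algebra.smul_def, mul_smul]; rfl⟩
  let F : LinearMap.ker (dualCover k) →ₗ[k] X :=
    ((arrCoef k 1 ∘ₗ LinearMap.proj 2).smulRight (vtx k 0 • x) +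
      (arrCoef k 0 ∘ₗ LinearMap.proj 0).smulRight (vtx k 1 • x) +
      (arrCoef k 2 ∘ₗ LinearMap.proj 1).smulRight (vtx k 2 • x)) ∘ₗ
      (LinearMap.ker (dualCover k)).subtype.restrictScalars k
  have hF : ∀ z, F z = arrCoef k 1 (z.1 2) • vtx k 0 • x + arrCoef k 0 (z.1 0) • vtx k 1 • x +
      arrCoef k 2 (z.1 1) • vtx k 2 • x := fun z => rfl
  have hav : ∀ a i, arr k a • vtx k i • x = 0 := by
    intro a i
    rw [arr_smul_vtx_smul, hx, ite_self]
  have hFv : ∀ i (z : LinearMap.ker (dualCover k)), F (vtx k i • z) = vtx k i • F z := by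
    intro i z
    simp [hF, arrCoef_mul, smul_comm (vtx k i) (_ : k), vtx_smul_vtx_smul, arrowTgt]
    fin_cases i <;> simp
  have hFa : ∀ a (z : LinearMap.ker (dualCover k)), F (arr k a • z) = arr k a • F z := by
    intro a z
    have hs := ((mem_ker_dualCover z.1).1 z.2).1
    have hs0 : vtxCoef k 0 (z.1 0) = 0 := hs 0
    have hs1 : vtxCoef k 1 (z.1 1) = 0 := hs 1
    have hs2 : vtxCoef k 1 (z.1 2) = 0 := hs 2
    simp [hF, arrCoef_mul, smul_comm (arr k a) (_ : k), hav, arrowSrc, hs0, hs1, hs2]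
  let f : LinearMap.ker (dualCover k) →ₗ[Aop k] X :=
    repHom (k := k) (X := LinearMap.ker (dualCover k)) (Y := X) F hFv hFa
  obtain ⟨g, hg⟩ := H _ (dualCover k) dualCover_surjective f
  have hsingle : ∀ a r, g (Pi.single a r) = r • g (Pi.single a 1) := by
    intro a r
    rw [← map_smul, ← Pi.single_smul, smul_eq_mul, mul_one]
  have h0 : vtx k 0 • x = arr k 1 • g (Pi.single 2 1) := by
    have := hg (syzygyβ k)
    rw [← hsingle]
    refine Eq.trans ?_ this.symm
    simp [f, hF, syzygyβ]
  have h2 : vtx k 2 • x = arr k 2 • g (Pi.single 1 1) := by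
    have := hg (syzygyγ k)
    rw [← hsingle]
    refine Eq.trans ?_ this.symm
    simp [f, hF, syzygyγ]
  have h1 : vtx k 1 • x = arr k 0 • g (Pi.single 0 1) - arr k 3 • g (Pi.single 3 1) := by
    have := hg (syzygyαδ k)
    rw [← hsingle, ← hsingle, ← map_sub]
    refine Eq.trans ?_ this.symm
    simp [f, hF, syzygyαδ]
  refine ⟨![g (Pi.single 0 1), g (Pi.single 2 1), g (Pi.single 1 1), -g (Pi.single 3 1)], ?_⟩
  rw [← sum_vtx_smul (k := k) x, h0, h1, h2]
  simp [Fin.sum_univ_four]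
  abel

end Presentation

theorem ExtensionsSplit.target_retract {R : Type} [Ring R] {X Y Z : Type} [AddCommGroup X]
    [Module R X] [AddCommGroup Y] [Module R Y] [AddCommGroup Z] [Module R Z]
    (H : ExtensionsSplit R X Z) (i : Y →ₗ[R] Z) (r : Z →ₗ[R] Y) (hr : r.comp i = LinearMap.id) :
    ExtensionsSplit R X Y := by
  intro E _ _ q hq f
  obtain ⟨g, hg⟩ := H E q hq (i.comp f)
  refine ⟨r.comp g, fun z => ?_⟩
  rw [LinearMap.comp_apply, hg]
  exact LinearMap.congr_fun hr (f z)

section Copresentation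

variable {k : Type} [Field k]

/-- The embedding of `A` into an injective module given by the functionals dual to the arrows. -/
noncomputable def injHull (k : Type) [Field k] : Aop k →ₗ[Aop k] (Fin 4 → DualA k) :=
  LinearMap.toSpanSingleton (Aop k) _ (arrDual k)

theorem injHull_apply (r : Aop k) (a : Fin 4) : injHull k r a = r • arrDual k a := rfl

theorem injHull_injective : Function.Injective (injHull k) := by
  rw [injective_iff_map_eq_zero]
  intro r hr
  have h : ∀ a, vtxCoef k (arrowSrc a) r = 0 ∧ arrCoef k a r = 0 := by
    intro a
    have h1 : r • arrDual k a = 0 := congrFun hr a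
    rw [smul_arrDual] at h1
    refine ⟨?_, ?_⟩
    · simpa [vtxDual, arrDual] using LinearMap.congr_fun h1 (arr k a).unop
    · simpa [vtxDual, arrDual] using LinearMap.congr_fun h1 (vtx k (arrowTgt a)).unop
  rw [eq_sum_coef r]
  simp [Fin.sum_univ_three, h, show vtxCoef k 0 r = 0 from (h 0).1,
    show vtxCoef k 1 r = 0 from (h 1).1, show vtxCoef k 2 r = 0 from (h 3).1]

set_option maxHeartbeats 1600000 in
theorem socleLeRadical_of_extensionsSplit_aop {X : Type} [AddCommGroup X] [Module (Aop k) X]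
    (H : ExtensionsSplit (Aop k) X (Aop k)) : SocleLeRadical k X := by
  intro x hx
  let _ : Module k X := Module.compHom X (algebraMap k (Aop k))
  have : IsScalarTower k (Aop k) X := ⟨fun c r x => by
    rw [Algebra.smul_def, mul_smul]; rfl⟩
  let rad : (Fin 4 → X) →ₗ[k] X := ∑ a, Algebra.lsmul k k X (arr k a) ∘ₗ LinearMap.proj a
  have hrad : ∀ y, rad y = ∑ a, arr k a • y a := fun y => by simp [rad]
  by_contra hcon
  have hx' : x ∉ LinearMap.range rad := by
    rintro ⟨y, hy⟩
    exact hcon ⟨y, by rw [← hrad, hy]⟩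
  obtain ⟨φ, hφx, hφ⟩ := Submodule.exists_le_ker_of_notMem hx'
  have hφa : ∀ a y, φ (arr k a • y) = 0 := by
    intro a y
    refine hφ ⟨Pi.single a y, ?_⟩
    rw [hrad, Finset.sum_eq_single a] <;> simp +contextual
  let ψ : Fin 3 → X →ₗ[k] k := fun i => φ ∘ₗ Algebra.lsmul k k X (vtx k i)
  have hψ : ∀ i y, ψ i y = φ (vtx k i • y) := fun i y => rfl
  let c : X →ₗ[k] (Fin 4 → DualA k) := LinearMap.pi
    ![(ψ 2).smulRight (arrDual k 3), (ψ 1).smulRight (arrDual k 1), 0,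
      (ψ 0).smulRight (arrDual k 0)]
  have hc : ∀ y, c y = ![φ (vtx k 2 • y) • arrDual k 3, φ (vtx k 1 • y) • arrDual k 1, 0,
      φ (vtx k 0 • y) • arrDual k 0] := by
    intro y
    funext a
    fin_cases a <;> simp [c, hψ]
  have hcv : ∀ i y, c (vtx k i • y) = vtx k i • c y := by
    intro i y
    rw [hc, hc]
    funext a
    fin_cases a <;> fin_cases i <;>
      simp [vtx_smul_vtx_smul, smul_comm (vtx k _) (_ : k), vtx_smul_arrDual, arrowSrc]
  have hca : ∀ a y, arr k a • c y = injHull k ((![φ (vtx k 0 • y) • arr k 3,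
      φ (vtx k 1 • y) • arr k 1, 0, φ (vtx k 2 • y) • arr k 0] : Fin 4 → Aop k) a) := by
    intro a y
    rw [hc]
    funext b
    rw [injHull_apply]
    fin_cases a <;> fin_cases b <;>
      simp [smul_comm (arr k _) (_ : k), arr_smul_arrDual, arrowTgt]
  have hca' : ∀ a y, c (arr k a • y) = 0 := by
    intro a y
    rw [hc]
    funext b
    fin_cases b <;> simp [vtx_smul_arr_smul, apply_ite φ, hφa]
  let C : X →ₗ[Aop k] ((Fin 4 → DualA k) ⧸ LinearMap.range (injHull k)) :=
    repHom ((LinearMap.range (injHull k)).mkQ.restrictScalars k ∘ₗ c)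
      (fun i y => by simp [hcv])
      (fun a y => by
        have : (LinearMap.range (injHull k)).mkQ (arr k a • c y) = 0 := by
          rw [hca]
          simp
        rw [map_smul] at this
        simpa [hca'] using this.symm)
  let E : Submodule (Aop k) (X × (Fin 4 → DualA k)) :=
    LinearMap.eqLocus (C.comp (LinearMap.fst _ _ _))
      ((LinearMap.range (injHull k)).mkQ.comp (LinearMap.snd _ _ _))
  let q : E →ₗ[Aop k] X := (LinearMap.fst _ _ _).comp E.subtype
  let t : X → E := fun y => ⟨(y, c y), rfl⟩
  have hq : Function.Surjective q := fun y => ⟨t y, rfl⟩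
  have hker : ∀ z : LinearMap.ker q, z.1.1.2 ∈ LinearMap.range (injHull k) := by
    rintro ⟨⟨⟨y, ξ⟩, h1⟩, h2⟩
    have h2' : y = 0 := h2
    have h1' : C y = (LinearMap.range (injHull k)).mkQ ξ := h1
    rw [h2', map_zero, eq_comm] at h1'
    exact (Submodule.Quotient.mk_eq_zero _).1 h1'
  let f : LinearMap.ker q →ₗ[Aop k] Aop k :=
    (LinearEquiv.ofInjective (injHull k) injHull_injective).symm.toLinearMap.comp
      (LinearMap.codRestrict _ ((LinearMap.snd _ _ _).comp
        (E.subtype.comp (LinearMap.ker q).subtype)) hker)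
  obtain ⟨g, hg⟩ := H E q hq f
  have key : ∀ a, vtxCoef k (arrowSrc a) (g (t x)) • arr k a = (![φ (vtx k 0 • x) • arr k 3,
      φ (vtx k 1 • x) • arr k 1, 0, φ (vtx k 2 • x) • arr k 0] : Fin 4 → Aop k) a := by
    intro a
    have hz : arr k a • t x ∈ LinearMap.ker q := hx a
    have h1 := hg ⟨arr k a • t x, hz⟩
    rw [← arr_mul_eq, ← smul_eq_mul, ← map_smul, h1]
    change (LinearEquiv.ofInjective (injHull k) injHull_injective).symm _ = _
    rw [LinearEquiv.symm_apply_eq]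
    ext1
    exact hca a x
  have h0 : φ (vtx k 0 • x) = 0 := by
    simpa [arrowSrc] using (congrArg (arrCoef k 3) (key 0)).symm
  have h2 : φ (vtx k 2 • x) = 0 := by
    simpa [arrowSrc] using (congrArg (arrCoef k 0) (key 3)).symm
  have h1 : φ (vtx k 1 • x) = 0 := by
    have h3 : vtxCoef k 1 (g (t x)) = 0 := by
      simpa [arrowSrc] using congrArg (arrCoef k 2) (key 2)
    simpa [arrowSrc, h3] using (congrArg (arrCoef k 1) (key 1)).symm
  refine hφx ?_
  rw [← sum_vtx_smul (k := k) x, map_add, map_add, h0, h1, h2]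
  simp

end Copresentation

section Converse

variable {k : Type} [Field k] {X : Type} [AddCommGroup X] [Module (Aop k) X]

theorem extensionsSplit_mA_left_iff : ExtensionsSplit (Aop k) (MA k) X ↔ SocleLeRadical k X :=
  ⟨fun H => socleLeRadical_of_extensionsSplit_dualA (H.of_retract (LinearMap.inr _ _ _)
    (LinearMap.snd _ _ _) (LinearMap.snd_comp_inr _ _ _)), extensionsSplit_mA⟩

theorem socleLeRadical_of_extensionsSplit_mA_right (H : ExtensionsSplit (Aop k) X (MA k)) :
    SocleLeRadical k X :=
  socleLeRadical_of_extensionsSplit_aop (H.target_retract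
    ((LinearMap.inl _ _ _).comp (opEquiv k).symm.toLinearMap)
    ((opEquiv k).toLinearMap.comp (LinearMap.fst _ _ _)) (by ext; simp))

theorem InAdd.extensionsSplit_mA_right (h : InAdd k (MA k) X) :
    ExtensionsSplit (Aop k) X (MA k) := by
  obtain ⟨n, ι, π, hπ⟩ := h
  exact ((extensionsSplit_mA socleLeRadical_mA).pi n).of_retract ι π hπ

end Converse

section Factorization

variable {k : Type} [Field k] {M X : Type} [AddCommGroup M] [Module (Aop k) M]
  [AddCommGroup X] [Module (Aop k) X]

/-- The endomorphism `f` factors through a finite direct sum of copies of `M`. -/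
def FactorsThroughAdd (k : Type) [Field k] (M : Type) {X : Type} [AddCommGroup M]
    [Module (Aop k) M] [AddCommGroup X] [Module (Aop k) X] (f : X →ₗ[Aop k] X) : Prop :=
  ∃ (n : ℕ) (ι : X →ₗ[Aop k] (Fin n → M)) (π : (Fin n → M) →ₗ[Aop k] X), π.comp ι = f

theorem FactorsThroughAdd.zero : FactorsThroughAdd k M (0 : X →ₗ[Aop k] X) :=
  ⟨0, 0, 0, by simp⟩

theorem FactorsThroughAdd.add {f g : X →ₗ[Aop k] X} (hf : FactorsThroughAdd k M f)
    (hg : FactorsThroughAdd k M g) : FactorsThroughAdd k M (f + g) := by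
  obtain ⟨n, ι, π, rfl⟩ := hf
  obtain ⟨m, ι', π', rfl⟩ := hg
  refine ⟨n + m, LinearMap.pi (Fin.addCases (fun i => LinearMap.proj i ∘ₗ ι)
    (fun i => LinearMap.proj i ∘ₗ ι')), π ∘ₗ LinearMap.funLeft _ _ (Fin.castAdd m) +
    π' ∘ₗ LinearMap.funLeft _ _ (Fin.natAdd n), ?_⟩
  ext x
  simp only [LinearMap.comp_apply, LinearMap.add_apply]
  congr 2 <;> ext i <;> simp [LinearMap.funLeft_apply]

theorem FactorsThroughAdd.sum {ι : Type*} (s : Finset ι) (f : ι → X →ₗ[Aop k] X)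
    (hf : ∀ i, FactorsThroughAdd k M (f i)) : FactorsThroughAdd k M (∑ i ∈ s, f i) :=
  Finset.sum_induction _ _ (fun _ _ => FactorsThroughAdd.add) .zero fun i _ => hf i

theorem FactorsThroughAdd.comp (π : M →ₗ[Aop k] X) (ι : X →ₗ[Aop k] M) :
    FactorsThroughAdd k M (π.comp ι) :=
  ⟨1, LinearMap.pi fun _ => ι, π ∘ₗ LinearMap.proj 0, by ext; simp⟩

theorem FactorsThroughAdd.comp_of_retract {N : Type} [AddCommGroup N] [Module (Aop k) N]
    (π : N →ₗ[Aop k] X) (ι : X →ₗ[Aop k] N) (i : N →ₗ[Aop k] M) (r : M →ₗ[Aop k] N)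
    (hr : r.comp i = LinearMap.id) : FactorsThroughAdd k M (π.comp ι) := by
  have h := FactorsThroughAdd.comp (k := k) (π.comp r) (i.comp ι)
  rwa [LinearMap.comp_assoc, ← LinearMap.comp_assoc ι i r, hr, LinearMap.id_comp] at h

theorem factorsThroughAdd_aop (π : Aop k →ₗ[Aop k] X) (ι : X →ₗ[Aop k] Aop k) :
    FactorsThroughAdd k (MA k) (π.comp ι) :=
  .comp_of_retract π ι ((LinearMap.inl _ _ _).comp (opEquiv k).symm.toLinearMap)
    ((opEquiv k).toLinearMap.comp (LinearMap.fst _ _ _)) (by ext; simp)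

theorem factorsThroughAdd_dualA (π : DualA k →ₗ[Aop k] X) (ι : X →ₗ[Aop k] DualA k) :
    FactorsThroughAdd k (MA k) (π.comp ι) :=
  .comp_of_retract π ι (LinearMap.inr _ _ _) (LinearMap.snd _ _ _) (LinearMap.snd_comp_inr _ _ _)

variable [Module k X] [IsScalarTower k (Aop k) X]

/-- Homomorphisms to `A` from a family of functionals indexed by the arrows. -/
noncomputable def toAop (θ : Fin 4 → X →ₗ[k] k) (h03 : ∀ y, θ 0 (arr k 3 • y) = 0)
    (h30 : ∀ y, θ 3 (arr k 0 • y) = 0) (h12 : ∀ y, θ 1 (arr k 1 • y) = θ 2 (arr k 2 • y)) :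
    X →ₗ[Aop k] Aop k :=
  repHom ((θ 0 ∘ₗ Algebra.lsmul k k X (arr k 0)).smulRight (vtx k 0) +
      (θ 1 ∘ₗ Algebra.lsmul k k X (arr k 1)).smulRight (vtx k 1) +
      (θ 3 ∘ₗ Algebra.lsmul k k X (arr k 3)).smulRight (vtx k 2) +
      ∑ a, (θ a ∘ₗ Algebra.lsmul k k X (vtx k (arrowTgt a))).smulRight (arr k a))
    (fun i x => by
      fin_cases i <;>
        simp [Fin.sum_univ_four, arr_smul_vtx_smul, vtx_smul_vtx_smul, arrowTgt, arrowSrc, mul_add,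
          vtx_mul_vtx, vtx_mul_arr])
    (fun b x => by
      fin_cases b <;>
        simp [Fin.sum_univ_four, arr_smul_arr_smul, vtx_smul_arr_smul, arrowTgt, arrowSrc, mul_add,
          arr_mul_vtx, arr_mul_arr, h03, h30, h12])

/-- Homomorphisms from `D(A)` from a family of elements indexed by the arrows. -/
noncomputable def ofDualA (t : Fin 4 → X) (h03 : arr k 0 • t 0 = arr k 3 • t 3)
    (h21 : arr k 2 • t 1 = 0) (h12 : arr k 1 • t 2 = 0) : DualA k →ₗ[Aop k] X :=
  repHom (∑ a, (LinearMap.applyₗ (arr k a).unop).smulRight (vtx k (arrowSrc a) • t a) +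
      ((LinearMap.applyₗ (vtx k 1).unop).smulRight (arr k 0 • t 0) +
      (LinearMap.applyₗ (vtx k 0).unop).smulRight (arr k 1 • t 1) +
      (LinearMap.applyₗ (vtx k 2).unop).smulRight (arr k 2 • t 2)))
    (fun i ξ => by
      fin_cases i <;>
        simp [Fin.sum_univ_four, smul_dualA_unop, smul_comm (vtx k _) (_ : k), vtx_smul_vtx_smul,
          vtx_smul_arr_smul, arrowTgt, arrowSrc, arr_mul_vtx, vtx_mul_vtx,
          -MulOpposite.unop_mul])
    (fun b ξ => by
      fin_cases b <;>
        simp [Fin.sum_univ_four, smul_dualA_unop, smul_comm (arr k _) (_ : k), arr_smul_vtx_smul,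
          arr_smul_arr_smul, arrowTgt, arrowSrc, arr_mul_arr, vtx_mul_arr,
          -MulOpposite.unop_mul, h03, h21, h12])

/-- The homomorphism to `D(A)` corresponding to a functional. -/
noncomputable def toDualA (φ : X →ₗ[k] k) : X →ₗ[Aop k] DualA k where
  toFun x := φ ∘ₗ (LinearMap.toSpanSingleton (Aop k) X x).restrictScalars k ∘ₗ
    (MulOpposite.opLinearEquiv k).toLinearMap
  map_add' x y := by
    ext r
    simp
  map_smul' r x := by
    ext y
    change φ (MulOpposite.op y • r • x) = φ (MulOpposite.op (r.unop * y) • x)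
    rw [smul_smul]
    rfl

theorem sum_repr_smul_smul {ι : Type*} [Fintype ι] (b : Module.Basis ι k X) (r : Aop k)
    (u : X →ₗ[k] X) (x : X) : ∑ i, b.repr x i • r • u (b i) = r • u x := by
  conv_rhs => rw [← b.sum_repr x, map_sum, Finset.smul_sum]
  refine Finset.sum_congr rfl fun i _ => ?_
  rw [map_smul, smul_comm]

variable [FiniteDimensional k X]

theorem exists_factorsThroughAdd_proj (s : Fin 4 → X →ₗ[k] X)
    (h03 : ∀ y, s 0 (arr k 3 • y) = 0) (h30 : ∀ y, s 3 (arr k 0 • y) = 0)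
    (h12 : ∀ y, s 1 (arr k 1 • y) = s 2 (arr k 2 • y)) :
    ∃ F : X →ₗ[Aop k] X, FactorsThroughAdd k (MA k) F ∧ ∀ x, F x =
      vtx k 0 • s 0 (arr k 0 • x) + vtx k 1 • s 1 (arr k 1 • x) + vtx k 2 • s 3 (arr k 3 • x) +
        ∑ a, arr k a • s a (vtx k (arrowTgt a) • x) := by
  let b := Module.finBasis k X
  refine ⟨∑ i, (LinearMap.toSpanSingleton (Aop k) X (b i)).comp
    (toAop (fun a => b.coord i ∘ₗ s a) (fun y => by simp [h03]) (fun y => by simp [h30])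
      (fun y => by simp [h12])), .sum _ _ fun i => factorsThroughAdd_aop _ _, fun x => ?_⟩
  have hb := fun r => sum_repr_smul_smul b r LinearMap.id
  simp only [LinearMap.id_apply] at hb
  simp [toAop, add_smul, Finset.sum_add_distrib, Finset.sum_smul, hb]
  rw [Finset.sum_comm]
  simp [hb]

theorem exists_factorsThroughAdd_inj (t : Fin 4 → X →ₗ[k] X)
    (h03 : ∀ y, arr k 0 • t 0 y = arr k 3 • t 3 y) (h21 : ∀ y, arr k 2 • t 1 y = 0)
    (h12 : ∀ y, arr k 1 • t 2 y = 0) :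
    ∃ F : X →ₗ[Aop k] X, FactorsThroughAdd k (MA k) F ∧ ∀ x, F x =
      ∑ a, vtx k (arrowSrc a) • t a (arr k a • x) + (arr k 0 • t 0 (vtx k 1 • x) +
        arr k 1 • t 1 (vtx k 0 • x) + arr k 2 • t 2 (vtx k 2 • x)) := by
  let b := Module.finBasis k X
  refine ⟨∑ i, (ofDualA (fun a => t a (b i)) (h03 _) (h21 _) (h12 _)).comp
    (toDualA (b.coord i)), .sum _ _ fun i => factorsThroughAdd_dualA _ _, fun x => ?_⟩
  simp [ofDualA, toDualA, Finset.sum_add_distrib, sum_repr_smul_smul]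
  rw [Finset.sum_comm]
  simp [sum_repr_smul_smul]

end Factorization

section Subspaces

variable {k V : Type*} [Field k] [AddCommGroup V] [Module k V]

theorem exists_projection_preserving (U W : Submodule k V) :
    ∃ p : V →ₗ[k] V, (∀ x, p x ∈ U) ∧ (∀ x ∈ U, p x = x) ∧ ∀ w ∈ W, p w ∈ W := by
  obtain ⟨C, hC, hW⟩ := IsModularLattice.exists_disjoint_and_sup_eq (inf_le_right : U ⊓ W ≤ W)
  have hCW : C ≤ W := hW ▸ le_sup_right
  have hd : Disjoint C U := by
    rw [disjoint_iff_inf_le] at hC ⊢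
    exact le_trans (le_inf (le_inf inf_le_right (inf_le_left.trans hCW)) inf_le_left) hC
  obtain ⟨D, hCD, hD⟩ := hd.exists_isCompl
  refine ⟨U.projection D hD.symm, fun x => Submodule.projection_apply_mem _ x,
    fun x hx => Submodule.projection_apply_of_mem_left _ hx, fun w hw => ?_⟩
  rw [← hW] at hw
  obtain ⟨u, hu, c, hc, rfl⟩ := Submodule.mem_sup.1 hw
  rw [map_add, Submodule.projection_apply_of_mem_left _ hu.1,
    (Submodule.projection_apply_eq_zero_iff _).2 (hCD hc), add_zero]
  exact hu.2

theorem exists_generalized_inverse {W : Type*} [AddCommGroup W] [Module k W] (f : V →ₗ[k] W) :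
    ∃ g : W →ₗ[k] V, ∀ x, f (g (f x)) = f x := by
  obtain ⟨h, hh⟩ := f.rangeRestrict.exists_rightInverse_of_surjective f.range_rangeRestrict
  obtain ⟨p, hp⟩ := (LinearMap.range f).subtype.exists_leftInverse_of_injective (by simp)
  refine ⟨h ∘ₗ p, fun x => ?_⟩
  have h1 := LinearMap.congr_fun hp (f.rangeRestrict x)
  have h2 := LinearMap.congr_fun hh (f.rangeRestrict x)
  simp only [LinearMap.comp_apply, LinearMap.id_apply] at h1 h2 ⊢
  rw [show f x = (LinearMap.range f).subtype (f.rangeRestrict x) from rfl, h1]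
  exact congrArg Subtype.val h2

end Subspaces

section Classification

variable {k : Type} [Field k] {X : Type} [AddCommGroup X] [Module (Aop k) X]

theorem SocleLeRadical.inAdd_of_finiteDimensional [Module k X] [IsScalarTower k (Aop k) X]
    [FiniteDimensional k X] (h : SocleLeRadical k X) : InAdd k (MA k) X := by
  let e : Fin 3 → X →ₗ[k] X := fun i => Algebra.lsmul k k X (vtx k i)
  let ar : Fin 4 → X →ₗ[k] X := fun a => Algebra.lsmul k k X (arr k a)
  have earr (i a) (x : X) : e i (ar a x) = if i = arrowTgt a then ar a x else 0 :=
    vtx_smul_arr_smul i a x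
  have arre (a i) (x : X) : ar a (e i x) = if i = arrowSrc a then ar a x else 0 :=
    arr_smul_vtx_smul a i x
  have arar (a b) (x : X) : ar a (ar b x) = 0 := arr_smul_arr_smul a b x
  have ee (i j) (x : X) : e i (e j x) = if i = j then e i x else 0 := vtx_smul_vtx_smul i j x
  have hsum (x : X) : e 0 x + e 1 x + e 2 x = x := sum_vtx_smul x
  obtain ⟨sα, hsα⟩ := exists_generalized_inverse (ar 0)
  obtain ⟨sδ, hsδ⟩ := exists_generalized_inverse (ar 3)
  obtain ⟨gβ, hgβ⟩ := exists_generalized_inverse (ar 1)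
  obtain ⟨gγ, hgγ⟩ := exists_generalized_inverse (ar 2)
  obtain ⟨pβ, hpβ, hpβ', -⟩ := exists_projection_preserving (LinearMap.ker (ar 1)) ⊥
  obtain ⟨pγ, hpγ, hpγ', hpγβ⟩ :=
    exists_projection_preserving (LinearMap.ker (ar 2)) (LinearMap.ker (ar 1))
  obtain ⟨q1, hq1, hq1', hq13⟩ :=
    exists_projection_preserving (LinearMap.range (ar 0)) (LinearMap.range (ar 3))
  obtain ⟨q3, hq3, hq3', hq31⟩ :=
    exists_projection_preserving (LinearMap.range (ar 3)) (LinearMap.range (ar 0))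
  simp only [LinearMap.mem_ker] at hpβ hpβ' hpγ hpγ' hpγβ
  have hq1a (x) : q1 (ar 0 x) = ar 0 x := hq1' _ ⟨x, rfl⟩
  have hq3a (x) : q3 (ar 3 x) = ar 3 x := hq3' _ ⟨x, rfl⟩
  have hq1b (x) : q3 (q1 (ar 3 x)) = q1 (ar 3 x) := hq3' _ (hq13 _ ⟨x, rfl⟩)
  have hq3b (x) : q1 (q3 (ar 0 x)) = q3 (ar 0 x) := hq1' _ (hq31 _ ⟨x, rfl⟩)
  have hrange (a) {x} (hx : x ∈ LinearMap.range (ar a)) {g : X →ₗ[k] X}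
      (hg : ∀ x, ar a (g (ar a x)) = ar a x) : ar a (g x) = x := by
    obtain ⟨y, rfl⟩ := hx
    exact hg y
  -- the retractions onto the radical of `e 0 X` and `e 2 X`
  let τβ := gβ ∘ₗ e 0 ∘ₗ (LinearMap.id - sα ∘ₗ ar 0)
  let τγ := gγ ∘ₗ e 2 ∘ₗ (LinearMap.id - sδ ∘ₗ ar 3)
  have hsoc (x) (hx : ∀ a, ar a x = 0) : ∃ y : Fin 4 → X, x = ∑ a, ar a (y a) := h x hx
  have hτβ (x) : ar 1 (τβ (e 0 x)) = e 0 x - e 0 (sα (ar 0 x)) := by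
    have h0 : e 0 x - e 0 (sα (ar 0 x)) ∈ LinearMap.range (ar 1) := by
      obtain ⟨y, hy⟩ := hsoc (e 0 x - e 0 (sα (ar 0 x))) (fun a => by
        fin_cases a <;> simp [arre, arrowSrc, hsα])
      have := congrArg (e 0) hy
      simp [ee, earr, arrowTgt, Fin.sum_univ_four] at this
      exact ⟨_, this.symm⟩
    have := hrange 1 h0 hgβ
    simpa [τβ, ee, arre, arrowSrc] using this
  have hτγ (x) : ar 2 (τγ (e 2 x)) = e 2 x - e 2 (sδ (ar 3 x)) := by
    have h0 : e 2 x - e 2 (sδ (ar 3 x)) ∈ LinearMap.range (ar 2) := by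
      obtain ⟨y, hy⟩ := hsoc (e 2 x - e 2 (sδ (ar 3 x))) (fun a => by
        fin_cases a <;> simp [arre, arrowSrc, hsδ])
      have := congrArg (e 2) hy
      simp [ee, earr, arrowTgt, Fin.sum_univ_four] at this
      exact ⟨_, this.symm⟩
    have := hrange 2 h0 hgγ
    simpa [τγ, ee, arre, arrowSrc] using this
  have hτββ (x) : τβ (ar 1 x) = gβ (ar 1 x) := by simp [τβ, arar, earr, arrowTgt]
  have hτγγ (x) : τγ (ar 2 x) = gγ (ar 2 x) := by simp [τγ, arar, earr, arrowTgt]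
  -- the four projections
  let r := pγ ∘ₗ pβ
  let pL := (LinearMap.id - pβ) ∘ₗ (LinearMap.id - pγ)
  let pK1 := pβ ∘ₗ (LinearMap.id - pγ)
  let pK3 := pγ ∘ₗ (LinearMap.id - pβ)
  have hrβ (x) : ar 1 (r x) = 0 := hpγβ _ (hpβ x)
  have hrγ (x) : ar 2 (r x) = 0 := hpγ _
  have hra (x) (h1 : ar 1 x = 0) (h2 : ar 2 x = 0) : r x = x := by
    simp [r, hpβ' x h1, hpγ' x h2]
  have hone (x) : pL x + pK3 x + pK1 x = x - r x := by
    simp only [pL, pK1, pK3, r, LinearMap.comp_apply, LinearMap.sub_apply, LinearMap.id_apply,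
      map_sub]
    abel
  have hpLβ (x) (hx : ar 1 x = 0) : pL x = 0 := by
    have := hpβ' (x - pγ x) (by rw [map_sub, hx, hpγβ x hx, sub_zero])
    simp only [pL, LinearMap.comp_apply, LinearMap.sub_apply, LinearMap.id_apply, this, sub_self]
  have hpLγ (x) (hx : ar 2 x = 0) : pL x = 0 := by simp [pL, hpγ' x hx]
  have hpK3β (x) (hx : ar 1 x = 0) : pK3 x = 0 := by simp [pK3, hpβ' x hx]
  have hpK1γ (x) (hx : ar 2 x = 0) : pK1 x = 0 := by simp [pK1, hpγ' x hx]
  have hK1 (x) : ar 1 (pK1 x) = 0 := hpβ _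
  have hK3 (x) : ar 2 (pK3 x) = 0 := hpγ _
  have hdβ {p : X →ₗ[k] X} (hp : ∀ x, ar 1 x = 0 → p x = 0) (x) : p (τβ (ar 1 x)) = p x := by
    rw [hτββ, ← sub_eq_zero, ← map_sub]
    exact hp _ (by rw [map_sub, hgβ, sub_self])
  have hdγ {p : X →ₗ[k] X} (hp : ∀ x, ar 2 x = 0 → p x = 0) (x) : p (τγ (ar 2 x)) = p x := by
    rw [hτγγ, ← sub_eq_zero, ← map_sub]
    exact hp _ (by rw [map_sub, hgγ, sub_self])
  let pA := q1 ∘ₗ (LinearMap.id - q3) ∘ₗ e 1 ∘ₗ r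
  let pB := q3 ∘ₗ (LinearMap.id - q1) ∘ₗ e 1 ∘ₗ r
  let pD := e 1 ∘ₗ r - pA - pB
  have her (x) : ∃ u v, e 1 (r x) = ar 0 u + ar 3 v := by
    obtain ⟨y, hy⟩ := hsoc (e 1 (r x)) (fun a => by
      fin_cases a <;> simp [arre, arrowSrc, hrβ, hrγ])
    have := congrArg (e 1) hy
    simp [ee, earr, arrowTgt, Fin.sum_univ_four] at this
    exact ⟨_, _, this⟩
  have hpD (x) : pD x ∈ LinearMap.range (ar 0) ∧ pD x ∈ LinearMap.range (ar 3) := by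
    obtain ⟨u, v, huv⟩ := her x
    have : pD x = q3 (ar 0 u) + q1 (ar 3 v) := by
      simp only [pD, pA, pB, LinearMap.comp_apply, LinearMap.sub_apply, LinearMap.id_apply,
        huv, map_sub, map_add, hq1a, hq3a, hq1b, hq3b]
      abel
    rw [this]
    exact ⟨add_mem (hq31 _ ⟨u, rfl⟩) (hq1 _), add_mem (hq3 _) (hq13 _ ⟨v, rfl⟩)⟩
  have hr0 (x) : e 1 (r (ar 0 x)) = ar 0 x := by
    rw [hra _ (arar _ _ _) (arar _ _ _), earr]; rfl
  have hr3 (x) : e 1 (r (ar 3 x)) = ar 3 x := by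
    rw [hra _ (arar _ _ _) (arar _ _ _), earr]; rfl
  have hpA3 (x) : pA (ar 3 x) = 0 := by simp [pA, hr3, hq3a]
  have hpB0 (x) : pB (ar 0 x) = 0 := by simp [pB, hr0, hq1a]
  have hAD (x) : pA (ar 0 x) + pD (ar 0 x) = ar 0 x := by simp [pD, hpB0, hr0]
  have hBD (x) : pB (ar 3 x) + pD (ar 3 x) = ar 3 x := by simp [pD, hpA3, hr3]
  have hsA (x) : ar 0 (sα (pA x)) = pA x := hrange 0 (hq1 _) hsα
  have hsB (x) : ar 3 (sδ (pB x)) = pB x := hrange 3 (hq3 _) hsδ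
  have hsD (x) : ar 0 (sα (pD x)) = pD x := hrange 0 (hpD x).1 hsα
  have hsD' (x) : ar 3 (sδ (pD x)) = pD x := hrange 3 (hpD x).2 hsδ
  obtain ⟨F, hF, hF'⟩ := exists_factorsThroughAdd_proj
    ![sα ∘ₗ pA, pL ∘ₗ τβ, pL ∘ₗ τγ, sδ ∘ₗ pB]
    (fun y => by
      change sα (pA (ar 3 y)) = 0
      rw [hpA3, map_zero])
    (fun y => by
      change sδ (pB (ar 0 y)) = 0
      rw [hpB0, map_zero])
    (fun y => by
      change pL (τβ (ar 1 y)) = pL (τγ (ar 2 y))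
      rw [hdβ hpLβ, hdγ hpLγ])
  obtain ⟨G, hG, hG'⟩ := exists_factorsThroughAdd_inj
    ![sα ∘ₗ pD, pK3 ∘ₗ τβ, pK1 ∘ₗ τγ, sδ ∘ₗ pD]
    (fun y => by
      change ar 0 (sα (pD y)) = ar 3 (sδ (pD y))
      rw [hsD, hsD'])
    (fun y => hK3 _) (fun y => hK1 _)
  obtain ⟨n, ι, π, hπ⟩ := hF.add hG
  refine ⟨n, ι, π, hπ.trans (LinearMap.ext fun x => ?_)⟩
  have hFx : F x = e 0 (sα (pA (ar 0 x))) + e 1 (pL (τβ (ar 1 x))) + e 2 (sδ (pB (ar 3 x))) +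
      (pA (e 1 x) + ar 1 (pL (τβ (e 0 x))) + ar 2 (pL (τγ (e 2 x))) + pB (e 1 x)) := by
    rw [hF', Fin.sum_univ_four, ← hsA (e 1 x), ← hsB (e 1 x)]
    rfl
  have hGx : G x = e 0 (sα (pD (ar 0 x))) + e 1 (pK3 (τβ (ar 1 x))) + e 1 (pK1 (τγ (ar 2 x))) +
      e 2 (sδ (pD (ar 3 x))) + (pD (e 1 x) + ar 1 (pK3 (τβ (e 0 x))) +
        ar 2 (pK1 (τγ (e 2 x)))) := by
    rw [hG', Fin.sum_univ_four, ← hsD (e 1 x)]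
    rfl
  have hI : e 0 (sα (pA (ar 0 x))) + e 0 (sα (pD (ar 0 x))) = e 0 (sα (ar 0 x)) := by
    rw [← map_add, ← map_add, hAD]
  have hV : e 2 (sδ (pB (ar 3 x))) + e 2 (sδ (pD (ar 3 x))) = e 2 (sδ (ar 3 x)) := by
    rw [← map_add, ← map_add, hBD]
  have hII : ar 1 (pL (τβ (e 0 x))) + ar 1 (pK3 (τβ (e 0 x))) = e 0 x - e 0 (sα (ar 0 x)) := by
    rw [← hτβ, ← add_zero (_ + _), ← hK1 (τβ (e 0 x)), ← map_add, ← map_add, hone, map_sub, hrβ,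
      sub_zero]
  have hVI : ar 2 (pL (τγ (e 2 x))) + ar 2 (pK1 (τγ (e 2 x))) = e 2 x - e 2 (sδ (ar 3 x)) := by
    rw [← hτγ, ← add_zero (ar 2 (pL _)), ← hK3 (τγ (e 2 x)), ← map_add, ← map_add, hone, map_sub,
      hrγ, sub_zero]
  have hIII : e 1 (pL (τβ (ar 1 x))) + e 1 (pK3 (τβ (ar 1 x))) + e 1 (pK1 (τγ (ar 2 x))) =
      e 1 x - e 1 (r (e 1 x)) := by
    have h1 : ar 1 x = ar 1 (e 1 x) := by rw [arre]; rfl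
    have h2 : ar 2 x = ar 2 (e 1 x) := by rw [arre]; rfl
    rw [h1, h2, hdβ hpLβ, hdβ hpK3β, hdγ hpK1γ, ← map_add, ← map_add, hone, map_sub, ee,
      if_pos rfl]
  have hIV : pA (e 1 x) + pB (e 1 x) + pD (e 1 x) = e 1 (r (e 1 x)) := by
    simp only [pD, LinearMap.sub_apply, LinearMap.comp_apply]
    abel
  rw [LinearMap.add_apply, hFx, hGx, LinearMap.id_apply]
  conv_rhs => rw [← hsum x]
  linear_combination (norm := module) hI + hII + hIII + hIV + hV + hVI

theorem SocleLeRadical.inAdd (h : SocleLeRadical k X) (hX : Module.Finite (Aop k) X) :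
    InAdd k (MA k) X := by
  let : Module k X := Module.compHom X (algebraMap k (Aop k))
  have : IsScalarTower k (Aop k) X :=
    ⟨fun c r x => by rw [Algebra.smul_def, mul_smul]; rfl⟩
  have := finite_aop (k := k)
  have : FiniteDimensional k X := Module.Finite.trans (Aop k) X
  exact h.inAdd_of_finiteDimensional

end Classification

section ProjectiveCovers

variable {k : Type} [Field k] {P : Type} [AddCommGroup P] [Module (Aop k) P]
  [Module k P] [IsScalarTower k (Aop k) P]

/-- The underlying vector space of a simple module. -/
def simpleSEquiv (k : Type) [Field k] (i : Fin 3) : k ≃ₗ[k] SimpleS k i :=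
  LinearEquiv.refl k k

/-- A functional on `e i X` vanishing on the radical induces a homomorphism to a simple module. -/
noncomputable def toSimpleS (i : Fin 3) (φ : P →ₗ[k] k)
    (hφ : ∀ a x, φ (vtx k i • arr k a • x) = 0) : P →ₗ[Aop k] SimpleS k i :=
  repHom ((simpleSEquiv k i).toLinearMap ∘ₗ φ ∘ₗ Algebra.lsmul k k P (vtx k i))
    (fun j x => by
      rw [smul_simpleS, vtxCoef_vtx]
      by_cases h : i = j
      · subst h
        simp [vtx_smul_vtx_smul]
      · simp [h, Ne.symm h, vtx_smul_vtx_smul])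
    (fun a x => by simp [smul_simpleS, hφ])

theorem toSimpleS_apply (i : Fin 3) (φ : P →ₗ[k] k)
    (hφ : ∀ a x, φ (vtx k i • arr k a • x) = 0) (x : P) :
    toSimpleS i φ hφ x = simpleSEquiv k i (φ (vtx k i • x)) :=
  rfl

theorem exists_eq_sum_arr_smul_of_superfluous {Z : Submodule (Aop k) P}
    (hZ : ∀ K : Submodule (Aop k) P, K ⊔ Z = ⊤ → K = ⊤) {z : P} (hz : z ∈ Z) :
    ∃ y : Fin 4 → P, z = ∑ a, arr k a • y a := by
  let ρ : (Fin 4 → P) →ₗ[k] P := ∑ a, Algebra.lsmul k k P (arr k a) ∘ₗ LinearMap.proj a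
  have hρ (y) : ρ y = ∑ a, arr k a • y a := by simp [ρ]
  have harr (a x) : arr k a • x ∈ LinearMap.range ρ :=
    ⟨Pi.single a x, by simp [hρ, Pi.single_apply, apply_ite]⟩
  suffices z ∈ LinearMap.range ρ by
    obtain ⟨y, rfl⟩ := this
    exact ⟨y, hρ y⟩
  have hv (i) : vtx k i • z ∈ LinearMap.range ρ := by
    by_contra hi
    obtain ⟨φ, hφz, hφ⟩ := Submodule.exists_le_ker_of_notMem hi
    have hψ (a x) : φ (vtx k i • arr k a • x) = 0 := by
      rw [vtx_smul_arr_smul]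
      split_ifs
      · exact hφ (harr a x)
      · exact map_zero φ
    have htop := hZ (LinearMap.ker (toSimpleS i φ hψ)) (by
      rw [eq_top_iff]
      intro p _
      let c : k := φ (vtx k i • p) / φ (vtx k i • z)
      refine Submodule.mem_sup.2 ⟨p - c • z, ?_, c • z, Z.smul_of_tower_mem c hz, by simp⟩
      rw [LinearMap.mem_ker, toSimpleS_apply, LinearEquiv.map_eq_zero_iff, smul_sub,
        smul_comm (vtx k i) c, map_sub, map_smul φ]
      exact sub_eq_zero.2 (div_mul_cancel₀ _ hφz).symm)
    have hmem : z ∈ LinearMap.ker (toSimpleS i φ hψ) := htop ▸ Submodule.mem_top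
    rw [LinearMap.mem_ker, toSimpleS_apply, LinearEquiv.map_eq_zero_iff] at hmem
    exact hφz hmem
  rw [← sum_vtx_smul (k := k) z]
  exact add_mem (add_mem (hv 0) (hv 1)) (hv 2)

variable {N : Type} [AddCommGroup N] [Module (Aop k) N] [Module k N] [IsScalarTower k (Aop k) N]

theorem vtx_smul_eq_zero_of_sum_arr_smul {P : Type} [AddCommGroup P] [Module (Aop k) P]
    [Module.Projective (Aop k) P]
    (hN : ∀ a (x : N), arr k a • x = 0) (ε : P →ₗ[Aop k] N) {p : Fin 4 → P}
    (hp : ∑ a, arr k a • p a = 0) (b : Fin 4) : vtx k (arrowSrc b) • ε (p b) = 0 := by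
  by_contra hb
  obtain ⟨φ, hφ, -⟩ := Submodule.exists_le_ker_of_notMem
    (p := (⊥ : Submodule k N)) (mt (Submodule.mem_bot k).1 hb)
  let ψ := toSimpleS (arrowSrc b) φ fun a x => by rw [hN, smul_zero, map_zero]
  obtain ⟨h, hh⟩ := Module.projective_lifting_property
    (LinearMap.toSpanSingleton (Aop k) _ (simpleSEquiv k (arrowSrc b) 1)) (ψ ∘ₗ ε)
    (fun s => ⟨algebraMap k (Aop k) ((simpleSEquiv k _).symm s), by
      rw [LinearMap.toSpanSingleton_apply, smul_simpleS, Algebra.algebraMap_eq_smul_one, map_smul,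
        vtxCoef_one, ← map_smul, smul_eq_mul, smul_eq_mul, mul_one, mul_one,
        LinearEquiv.apply_symm_apply]⟩)
  have h1 : vtxCoef k (arrowSrc b) (h (p b)) = φ (vtx k (arrowSrc b) • ε (p b)) := by
    have := LinearMap.congr_fun hh (p b)
    rw [LinearMap.comp_apply, LinearMap.toSpanSingleton_apply, smul_simpleS, ← map_smul,
      LinearMap.comp_apply, toSimpleS_apply, smul_eq_mul, mul_one] at this
    exact (simpleSEquiv k _).injective this
  have h2 := congrArg (fun x => arrCoef k b (h x)) hp
  simp only [map_sum, map_smul, smul_eq_mul, arr_mul_eq, arrCoef_arr, map_zero] at h2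
  simp at h2
  exact hφ (h1 ▸ h2)

theorem arr_smul_eq_zero_of_superfluous {Z : Submodule (Aop k) P}
    (hZ : ∀ K : Submodule (Aop k) P, K ⊔ Z = ⊤ → K = ⊤) (a : Fin 4) (z : Z) :
    arr k a • z = 0 := by
  obtain ⟨y, hy⟩ := exists_eq_sum_arr_smul_of_superfluous hZ z.2
  ext
  rw [Submodule.coe_smul, hy, Finset.smul_sum]
  simp [arr_smul_arr_smul]

theorem finiteDimensional_of_superfluous [FiniteDimensional k N] (ε : P →ₗ[Aop k] N)
    (hε : Function.Surjective ε)
    (hZ : ∀ K : Submodule (Aop k) P, K ⊔ LinearMap.ker ε = ⊤ → K = ⊤) :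
    FiniteDimensional k P := by
  obtain ⟨σ, hσ⟩ := (ε.restrictScalars k).exists_rightInverse_of_surjective
    (LinearMap.range_eq_top.2 hε)
  have hdec (p : P) : ∃ y : Fin 4 → P, p - σ (ε p) = ∑ a, arr k a • y a :=
    exists_eq_sum_arr_smul_of_superfluous hZ (by
      rw [LinearMap.mem_ker, map_sub, sub_eq_zero]
      exact (LinearMap.congr_fun hσ (ε p)).symm)
  let ρ : (Fin 4 → N) →ₗ[k] P := ∑ a, Algebra.lsmul k k P (arr k a) ∘ₗ σ ∘ₗ LinearMap.proj a
  refine Module.Finite.of_surjective (σ.coprod ρ) fun p => ?_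
  obtain ⟨y, hy⟩ := hdec p
  refine ⟨(ε p, fun a => ε (y a)), ?_⟩
  rw [LinearMap.coprod_apply, eq_comm, ← sub_eq_iff_eq_add', hy]
  simp only [ρ, LinearMap.sum_apply, LinearMap.comp_apply, LinearMap.proj_apply,
    Algebra.lsmul_coe]
  refine Finset.sum_congr rfl fun a _ => ?_
  obtain ⟨w, hw⟩ := hdec (y a)
  rw [← sub_eq_zero, ← smul_sub, hw, Finset.smul_sum]
  simp [arr_smul_arr_smul]

/-- The dimension of `X` at the vertex `i`. -/
noncomputable def vtxDim (k : Type) [Field k] (X : Type) [AddCommGroup X] [Module (Aop k) X]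
    [Module k X] [IsScalarTower k (Aop k) X] (i : Fin 3) : ℕ :=
  Module.finrank k (LinearMap.range (Algebra.lsmul k k X (vtx k i)))

theorem vtx_smul_of_mem_range {i : Fin 3} {x : N}
    (hx : x ∈ LinearMap.range (Algebra.lsmul k k N (vtx k i))) : vtx k i • x = x := by
  obtain ⟨y, rfl⟩ := hx
  simp [vtx_smul_vtx_smul]

/-- Multiplication by an arrow, after a section of `ε`, lands in the kernel of `ε`. -/
noncomputable def arrLift (hN : ∀ a (x : N), arr k a • x = 0) (ε : P →ₗ[Aop k] N) (a : Fin 4)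
    (σ : N →ₗ[k] P) :
    LinearMap.range (Algebra.lsmul k k N (vtx k (arrowSrc a))) →ₗ[k]
      LinearMap.range (Algebra.lsmul k k (LinearMap.ker ε) (vtx k (arrowTgt a))) :=
  let f : N →ₗ[k] LinearMap.ker ε :=
    { toFun x := ⟨arr k a • σ x, by rw [LinearMap.mem_ker, map_smul, hN]⟩
      map_add' x y := by ext; simp
      map_smul' c x := by ext; simp [smul_comm c] }
  f.restrict fun x _ => ⟨f x, by ext; simp [f, vtx_smul_arr_smul]⟩

theorem arrLift_coe (hN : ∀ a (x : N), arr k a • x = 0) (ε : P →ₗ[Aop k] N) (a : Fin 4)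
    (σ : N →ₗ[k] P) (x) : ((arrLift hN ε a σ x : LinearMap.ker ε) : P) = arr k a • σ x :=
  rfl

variable [Module.Projective (Aop k) P] [FiniteDimensional k P]

theorem vtxDim_le_vtxDim_ker (hN : ∀ a (x : N), arr k a • x = 0) (ε : P →ₗ[Aop k] N)
    (hε : Function.Surjective ε) (b : Fin 4) :
    vtxDim k N (arrowSrc b) ≤ vtxDim k (LinearMap.ker ε) (arrowTgt b) := by
  obtain ⟨σ, hσ⟩ := (ε.restrictScalars k).exists_rightInverse_of_surjective
    (LinearMap.range_eq_top.2 hε)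
  have hσ' (x : N) : ε (σ x) = x := LinearMap.congr_fun hσ x
  have : FiniteDimensional k (LinearMap.ker ε) :=
    inferInstanceAs (FiniteDimensional k ((LinearMap.ker ε).restrictScalars k))
  refine LinearMap.finrank_le_finrank_of_injective (f := arrLift hN ε b σ)
    ((injective_iff_map_eq_zero _).2 fun x hx => ?_)
  have hx' : arr k b • σ x = 0 := by rw [← arrLift_coe hN ε, hx]; rfl
  have := vtx_smul_eq_zero_of_sum_arr_smul hN ε (p := Pi.single b (σ x))
    (by simp [Pi.single_apply, apply_ite, hx']) b
  rw [Pi.single_eq_same, hσ', vtx_smul_of_mem_range x.2] at this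
  exact Subtype.ext this

theorem vtxDim_add_vtxDim_le_vtxDim_ker (hN : ∀ a (x : N), arr k a • x = 0) (ε : P →ₗ[Aop k] N)
    (hε : Function.Surjective ε) : vtxDim k N 0 + vtxDim k N 2 ≤ vtxDim k (LinearMap.ker ε) 1 := by
  have : FiniteDimensional k N := Module.Finite.of_surjective (ε.restrictScalars k) hε
  obtain ⟨σ, hσ⟩ := (ε.restrictScalars k).exists_rightInverse_of_surjective
    (LinearMap.range_eq_top.2 hε)
  have hσ' (x : N) : ε (σ x) = x := LinearMap.congr_fun hσ x
  have : FiniteDimensional k (LinearMap.ker ε) :=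
    inferInstanceAs (FiniteDimensional k ((LinearMap.ker ε).restrictScalars k))
  unfold vtxDim
  rw [← Module.finrank_prod]
  refine LinearMap.finrank_le_finrank_of_injective
    (f := (arrLift hN ε 0 σ).coprod (arrLift hN ε 3 σ))
    ((injective_iff_map_eq_zero _).2 fun x hx => ?_)
  have hx' : arr k 0 • σ x.1 + arr k 3 • σ x.2 = 0 := by
    have := congrArg (fun z => z.1.1) hx
    exact this
  have h := vtx_smul_eq_zero_of_sum_arr_smul hN ε (p := ![σ x.1, 0, 0, σ x.2])
    (by simpa [Fin.sum_univ_four] using hx')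
  have h0 : vtx k 0 • ε (σ x.1) = 0 := h 0
  have h3 : vtx k 2 • ε (σ x.2) = 0 := h 3
  rw [hσ', vtx_smul_of_mem_range (Subtype.prop _)] at h0 h3
  exact Prod.ext (Subtype.ext h0) (Subtype.ext h3)

end ProjectiveCovers

section Complexity

variable {k : Type} [Field k]

theorem vtxDim_simpleS (i : Fin 3) : 1 ≤ vtxDim k (SimpleS k i) i := by
  have : FiniteDimensional k (SimpleS k i) := inferInstanceAs (FiniteDimensional k k)
  refine Submodule.one_le_finrank_iff.2 fun h => one_ne_zero (α := k) ?_
  have := LinearMap.congr_fun (LinearMap.range_eq_bot.1 h) (simpleSEquiv k i 1)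
  simp [smul_simpleS] at this

variable {P : ℕ → Type} [∀ n, AddCommGroup (P n)] [∀ n, Module (Aop k) (P n)]
  [∀ n, Module k (P n)] [∀ n, IsScalarTower k (Aop k) (P n)]

/-- A submodule `Z` of a finite-dimensional module that is annihilated by the arrows, with given
lower bounds for the dimensions at the middle vertex and at the outer vertices. -/
structure SyzygyBound {Q : Type} [AddCommGroup Q] [Module (Aop k) Q] [Module k Q]
    [IsScalarTower k (Aop k) Q] (Z : Submodule (Aop k) Q) (a b : ℕ) : Prop where
  finite : FiniteDimensional k Q
  arr_smul : ∀ c (z : Z), arr k c • z = 0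
  le_mid : a ≤ vtxDim k Z 1
  le_outer : b ≤ vtxDim k Z 0 + vtxDim k Z 2

theorem syzygyBound_ker {N Q : Type} [AddCommGroup N] [Module (Aop k) N] [Module k N]
    [IsScalarTower k (Aop k) N] [AddCommGroup Q] [Module (Aop k) Q] [Module k Q]
    [IsScalarTower k (Aop k) Q] [Module.Projective (Aop k) Q] [FiniteDimensional k N]
    (hN : ∀ a (x : N), arr k a • x = 0) (ε : Q →ₗ[Aop k] N) (hε : Function.Surjective ε)
    (hZ : ∀ K : Submodule (Aop k) Q, K ⊔ LinearMap.ker ε = ⊤ → K = ⊤) {a b : ℕ}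
    (ha : a ≤ vtxDim k N 1) (hb : b ≤ vtxDim k N 0 + vtxDim k N 2) :
    SyzygyBound (LinearMap.ker ε) b (2 * a) := by
  have := finiteDimensional_of_superfluous ε hε hZ
  refine ⟨this, arr_smul_eq_zero_of_superfluous hZ,
    hb.trans (vtxDim_add_vtxDim_le_vtxDim_ker hN ε hε), ?_⟩
  have h1 := vtxDim_le_vtxDim_ker hN ε hε 1
  have h2 := vtxDim_le_vtxDim_ker hN ε hε 2
  simp only [arrowSrc, arrowTgt, Matrix.cons_val] at h1 h2
  omega

theorem SyzygyBound.ker {Q Q' : Type} [AddCommGroup Q] [Module (Aop k) Q] [Module k Q]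
    [IsScalarTower k (Aop k) Q] [AddCommGroup Q'] [Module (Aop k) Q'] [Module k Q']
    [IsScalarTower k (Aop k) Q'] [Module.Projective (Aop k) Q'] {Z : Submodule (Aop k) Q}
    {a b : ℕ} (h : SyzygyBound Z a b) (d : Q' →ₗ[Aop k] Q) (hd : LinearMap.range d = Z)
    (hZ : ∀ K : Submodule (Aop k) Q', K ⊔ LinearMap.ker d = ⊤ → K = ⊤) :
    SyzygyBound (LinearMap.ker d) b (2 * a) := by
  have := h.finite
  have hf : FiniteDimensional k Z := inferInstanceAs (FiniteDimensional k (Z.restrictScalars k))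
  obtain ⟨e, he, hsurj⟩ : ∃ e : Q' →ₗ[Aop k] Z, LinearMap.ker e = LinearMap.ker d ∧
      Function.Surjective e := by
    subst hd
    exact ⟨d.rangeRestrict, d.ker_rangeRestrict, d.surjective_rangeRestrict⟩
  rw [← he] at hZ ⊢
  have key := syzygyBound_ker (k := k) (N := Z) (Q := Q') h.arr_smul
  exact key e hsurj hZ h.le_mid h.le_outer

theorem IsMinimalProjRes.syzygyBound {ε : P 0 →ₗ[Aop k] SimpleS k 1}
    {d : ∀ n, P (n + 1) →ₗ[Aop k] P n} (h : IsMinimalProjRes k P ε d) (m : ℕ) :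
    SyzygyBound (LinearMap.ker (d (2 * m))) (2 ^ (m + 1)) 0 := by
  obtain ⟨hP, hε, h0, hd, hs0, hs⟩ := h
  have : FiniteDimensional k (SimpleS k 1) := inferInstanceAs (FiniteDimensional k k)
  induction m with
  | zero =>
    exact (syzygyBound_ker (fun a x => by simp [smul_simpleS]) ε hε hs0 (vtxDim_simpleS 1)
      (Nat.zero_le _)).ker (d 0) h0 (hs 0)
  | succ m ih =>
    have h1 := (ih.ker (d (2 * m + 1)) (hd _) (hs _)).ker (d (2 * m + 2)) (hd _) (hs _)
    rwa [← pow_succ'] at h1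

theorem SyzygyBound.le_finrank {Q : Type} [AddCommGroup Q] [Module (Aop k) Q] [Module k Q]
    [IsScalarTower k (Aop k) Q] {Z : Submodule (Aop k) Q} {a b : ℕ} (h : SyzygyBound Z a b) :
    a ≤ Module.finrank k Q := by
  have := h.finite
  have hf : FiniteDimensional k Z := inferInstanceAs (FiniteDimensional k (Z.restrictScalars k))
  exact h.le_mid.trans ((Submodule.finrank_le _).trans (Submodule.finrank_le (Z.restrictScalars k)))

theorem not_forall_two_pow_le (b : ℕ) (c : ℝ) :
    ¬ ∀ m : ℕ, (2 : ℝ) ^ m ≤ c * ((2 * m + 1 : ℕ) : ℝ) ^ ((b : ℝ) - 1) := by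
  intro H
  have hlim := (tendsto_pow_const_div_const_pow_of_one_lt b (one_lt_two (α := ℝ))).const_mul
    (|c| * 3 ^ b)
  rw [mul_zero] at hlim
  obtain ⟨m, hm, hm1⟩ := ((hlim.eventually (gt_mem_nhds one_pos)).and
    (Filter.eventually_ge_atTop 1)).exists
  have h1 : (1 : ℝ) ≤ m := by exact_mod_cast hm1
  have h2 : ((2 * m + 1 : ℕ) : ℝ) ^ ((b : ℝ) - 1) ≤ 3 ^ b * (m : ℝ) ^ b := by
    rw [← mul_pow, ← Real.rpow_natCast]
    push_cast
    refine (Real.rpow_le_rpow_of_exponent_le (by linarith) (sub_le_self _ zero_le_one)).trans ?_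
    exact Real.rpow_le_rpow (by positivity) (by linarith) (by positivity)
  rw [← mul_div_assoc, div_lt_one (by positivity), mul_assoc] at hm
  refine absurd (H m) (not_le.2 (lt_of_le_of_lt ?_ hm))
  exact (mul_le_mul_of_nonneg_right (le_abs_self c) (by positivity)).trans
    (mul_le_mul_of_nonneg_left h2 (abs_nonneg c))

theorem IsMinimalProjRes.not_polynomial_growth {ε : P 0 →ₗ[Aop k] SimpleS k 1}
    {d : ∀ n, P (n + 1) →ₗ[Aop k] P n} (h : IsMinimalProjRes k P ε d) :
    ¬ ∃ (b : ℕ) (c : ℝ), 0 < c ∧ ∀ n : ℕ, 1 ≤ n →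
      (Module.finrank k (P n) : ℝ) ≤ c * (n : ℝ) ^ ((b : ℝ) - 1) := by
  rintro ⟨b, c, hc, H⟩
  refine not_forall_two_pow_le b c fun m => le_trans ?_ (H (2 * m + 1) (by omega))
  have := (Nat.pow_le_pow_right two_pos m.le_succ).trans (h.syzygyBound m).le_finrank
  exact_mod_cast this

end Complexity

/-- **Main Theorem** (Marczinzik–Vaso). Over any field `k`, the algebra `A = kQ/J²`
(where `Q` is the quiver `1 ⇄ 2 ⇄ 3`) is a connected finite-dimensional algebra
admitting the 2-cluster tilting module `M = A ⊕ D(A)`, and the simple `A`-module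
`S₂` at the middle vertex has infinite complexity. -/
theorem exists_twoClusterTilting_and_simple_with_infinite_complexity
    (k : Type) [Field k] :
    FiniteDimensional k (AlgA k) ∧
    (∀ z : AlgA k, z ∈ Subring.center (AlgA k) → z * z = z → z = 0 ∨ z = 1) ∧
    IsTwoClusterTilting k (MA k) ∧
    IsSimpleModule (Aop k) (SimpleS k 1) ∧
    (∀ (P : ℕ → Type) [∀ n, AddCommGroup (P n)] [∀ n, Module (Aop k) (P n)]
        [∀ n, Module k (P n)] [∀ n, IsScalarTower k (Aop k) (P n)]
        (ε : P 0 →ₗ[Aop k] SimpleS k 1) (d : ∀ n, P (n + 1) →ₗ[Aop k] P n),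
        IsMinimalProjRes k P ε d →
        ¬ ∃ (b : ℕ) (c : ℝ), 0 < c ∧
            ∀ n : ℕ, 1 ≤ n →
              (Module.finrank k (P n) : ℝ) ≤ c * (n : ℝ) ^ ((b : ℝ) - 1)) := by
  refine ⟨finiteDimensional_algA, eq_zero_or_one_of_central_idempotent, ⟨fun X _ _ hX => ?_,
    fun X _ _ hX => ?_⟩, isSimpleModule_simpleS 1, fun P _ _ _ _ ε d h =>
      h.not_polynomial_growth⟩
  · exact Iff.trans ⟨fun h => extensionsSplit_mA_left_iff.2 (h.socleLeRadical socleLeRadical_mA),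
      fun h => (extensionsSplit_mA_left_iff.1 h).inAdd hX⟩ extensionsSplit_iff_subsingleton_ext
  · exact Iff.trans ⟨fun h => h.extensionsSplit_mA_right,
      fun h => (socleLeRadical_of_extensionsSplit_mA_right h).inAdd hX⟩
      extensionsSplit_iff_subsingleton_ext
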